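/- Let n = 2^r p, where p is an odd prime and r ≥ 2, and let S be a sequence in Z_n which has exactly one odd term. Then S is a U(n)-extremal sequence for the Gao constant if and only if S is U(n)-equivalent to a sequence of one of the following forms: (⋆) (b_1, q_1 b_2, q_1 q_2 b_3, …, q_1 ⋯ q_{k−1} b_k, 0, …, 0) where n = q_1 ⋯ q_k is a factorization into primes, each b_i is coprime to q_i, and 0 occurs n − 1 times; (∗) (b_1, q_1 b_2, …, q_1 ⋯ q_{k−1} b_k, n/2, …, n/2, 0, …, 0) where n = 2 q_1 ⋯ q_k with the q_i prime, each b_i coprime to q_i, n/2 occurring m times with m odd, and 0 occurring n − m times; (∗∗) (a_0, 2a_1, …, 2^{s−1} a_{s−1}, c, 2^s b_1, 2^s q_1 b_2, …, 2^s q_1 ⋯ q_{k−1} b_k, n/2, …, n/2) where n = 2^{s+1} q_1 ⋯ q_k with the q_i odd primes, each a_i odd, c divisible by 2^{s+1}, each b_i odd and coprime to q_i, and n/2 occurring n − 1 times (for k = 1 the middle block is just 2^s). -/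

import Mathlib

open Classical in
/-- The number of terms of the sequence `S` satisfying the predicate `P`. -/
noncomputable def pcount {α : Type*} (P : α → Prop) (S : List α) : ℕ :=
  S.countP fun x => decide (P x)

/-- `S` is an `A`-weighted zero-sum sequence in `ZMod n`: there are weights
`a i ∈ A` with `∑ a i * x i = 0`. -/
def IsWZSum {n : ℕ} (A : Set (ZMod n)) (S : List (ZMod n)) : Prop :=
  ∃ w : List (ZMod n), w.length = S.length ∧ (∀ a ∈ w, a ∈ A) ∧
    (List.zipWith (· * ·) w S).sum = 0

/-- `S` has an `A`-weighted zero-sum subsequence of length `t ≥ 1`. -/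
def HasWZSS {n : ℕ} (A : Set (ZMod n)) (S : List (ZMod n)) (t : ℕ) : Prop :=
  0 < t ∧ ∃ T : List (ZMod n), T.Sublist S ∧ T.length = t ∧ IsWZSum A T

/-- `S` has a nonempty `A`-weighted zero-sum subsequence. -/
def HasWZS {n : ℕ} (A : Set (ZMod n)) (S : List (ZMod n)) : Prop :=
  ∃ T : List (ZMod n), T.Sublist S ∧ T ≠ [] ∧ IsWZSum A T

/-- The `A`-weighted Davenport constant `D_A(n)`: the least `k > 0` such that every
sequence of length `k` in `ZMod n` has a nonempty `A`-weighted zero-sum subsequence. -/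
noncomputable def DavC (n : ℕ) (A : Set (ZMod n)) : ℕ :=
  sInf {k | 0 < k ∧ ∀ S : List (ZMod n), S.length = k → HasWZS A S}

/-- The `A`-weighted Gao constant `E_A(n)`: the least `k > 0` such that every
sequence of length `k` in `ZMod n` has an `A`-weighted zero-sum subsequence of length `n`. -/
noncomputable def GaoC (n : ℕ) (A : Set (ZMod n)) : ℕ :=
  sInf {k | 0 < k ∧ ∀ S : List (ZMod n), S.length = k → HasWZSS A S n}

/-- The set of units of `ZMod n`. -/
def U (n : ℕ) : Set (ZMod n) := {x | IsUnit x}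

/-- An `A`-extremal sequence for the Gao constant: a sequence of length `E_A(n) - 1`
with no `A`-weighted zero-sum subsequence of length `n`. -/
def IsGaoExtremal (n : ℕ) (A : Set (ZMod n)) (S : List (ZMod n)) : Prop :=
  S.length = GaoC n A - 1 ∧ ¬ HasWZSS A S n

/-- `S` and `T` are `A`-equivalent: there are a unit `c`, weights `a i ∈ A` and a
permutation matching the multiset of terms `c * y j` with the multiset `a i * x i`. -/
def AEquiv {n : ℕ} (A : Set (ZMod n)) (S T : List (ZMod n)) : Prop :=
  ∃ c : ZMod n, IsUnit c ∧ ∃ w : List (ZMod n), w.length = S.length ∧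
    (∀ a ∈ w, a ∈ A) ∧ (T.map fun y => c * y).Perm (List.zipWith (· * ·) w S)
/-! ### Combinatorics of divisibility types

A residue modulo `2 ^ r * p` is determined up to units by a pair `(e, z)`, where
`e ≤ r` is its (truncated) `2`-adic valuation and `z` records whether it is nonzero modulo `p`. -/

/-- The multiset of valuations admits odd weights making the sum zero modulo `2 ^ r`. -/
def TwoBalanced (r : ℕ) (T : Multiset (ℕ × Bool)) : Prop :=
  (∀ x ∈ T, x.1 = r) ∨
    ∃ e < r, (∀ x ∈ T, e ≤ x.1) ∧ 0 < T.countP (·.1 = e) ∧ T.countP (·.1 = e) % 2 = 0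

/-- The types in `T` admit unit weights making the sum zero modulo `2 ^ r * p`. -/
def UnitBalanced (r : ℕ) (T : Multiset (ℕ × Bool)) : Prop :=
  TwoBalanced r T ∧ T.countP (·.2 = true) ≠ 1

/-- `M` has a balanced sub-multiset with `n` elements. -/
def HasBalanced (n r : ℕ) (M : Multiset (ℕ × Bool)) : Prop :=
  ∃ T ≤ M, T.card = n ∧ UnitBalanced r T

theorem HasBalanced.mono {n r : ℕ} {M N : Multiset (ℕ × Bool)} (h : HasBalanced n r M)
    (hMN : M ≤ N) : HasBalanced n r N := by
  obtain ⟨T, hT, h⟩ := h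
  exact ⟨T, hT.trans hMN, h⟩

theorem Multiset.exists_le_card_eq_of_le {α : Type*} {s : Multiset α} {k : ℕ} (h : k ≤ s.card) :
    ∃ t ≤ s, t.card = k := by
  have : 0 < (Multiset.powersetCard k s).card := by
    rw [Multiset.card_powersetCard]; exact Nat.choose_pos h
  obtain ⟨t, ht⟩ := Multiset.card_pos_iff_exists_mem.1 this
  exact ⟨t, Multiset.mem_powersetCard.1 ht⟩

/-- Number of elements of `M` with valuation `j` and second component `b`. -/
def cntEq (j : ℕ) (b : Bool) (M : Multiset (ℕ × Bool)) : ℕ :=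
  M.countP fun x => x.1 = j ∧ x.2 = b

/-- Number of elements of `M` with valuation different from `j` and second component `b`. -/
def cntNe (j : ℕ) (b : Bool) (M : Multiset (ℕ × Bool)) : ℕ :=
  M.countP fun x => x.1 ≠ j ∧ x.2 = b

theorem countP_fst (j : ℕ) (M : Multiset (ℕ × Bool)) :
    M.countP (·.1 = j) = cntEq j true M + cntEq j false M := by
  induction M using Multiset.induction_on with
  | empty => simp [cntEq]
  | cons a s ih =>
    simp only [cntEq] at ih
    rcases a with ⟨e, _ | _⟩ <;> by_cases h : e = j <;> simp [cntEq, h, ih] <;> omega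

theorem countP_snd (j : ℕ) (M : Multiset (ℕ × Bool)) :
    M.countP (·.2 = true) = cntEq j true M + cntNe j true M := by
  induction M using Multiset.induction_on with
  | empty => simp [cntEq, cntNe]
  | cons a s ih =>
    simp only [cntEq, cntNe] at ih
    rcases a with ⟨e, _ | _⟩ <;> by_cases h : e = j <;> simp [cntEq, cntNe, h, ih] <;> omega

theorem card_eq_cnt (j : ℕ) (M : Multiset (ℕ × Bool)) :
    M.card = cntEq j true M + cntEq j false M + cntNe j true M + cntNe j false M := by
  induction M using Multiset.induction_on with
  | empty => simp [cntEq, cntNe]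
  | cons a s ih =>
    simp only [cntEq, cntNe] at ih
    rcases a with ⟨e, _ | _⟩ <;> by_cases h : e = j <;> simp [cntEq, cntNe, h, ih] <;> omega

/-- Sub-multisets with prescribed class sizes exist. -/
theorem exists_le_cnt (j : ℕ) (M : Multiset (ℕ × Bool)) {x₁ x₀ y₁ y₀ : ℕ}
    (hx₁ : x₁ ≤ cntEq j true M) (hx₀ : x₀ ≤ cntEq j false M)
    (hy₁ : y₁ ≤ cntNe j true M) (hy₀ : y₀ ≤ cntNe j false M) :
    ∃ T ≤ M, cntEq j true T = x₁ ∧ cntEq j false T = x₀ ∧ cntNe j true T = y₁ ∧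
      cntNe j false T = y₀ := by
  induction M using Multiset.induction_on generalizing x₁ x₀ y₁ y₀ with
  | empty => exact ⟨0, le_rfl, by simp_all [cntEq, cntNe]⟩
  | cons a s ih =>
    have key : ∀ {u₁ u₀ v₁ v₀ : ℕ}, u₁ ≤ cntEq j true s → u₀ ≤ cntEq j false s →
        v₁ ≤ cntNe j true s → v₀ ≤ cntNe j false s →
        (u₁ = x₁ ∧ u₀ = x₀ ∧ v₁ = y₁ ∧ v₀ = y₀ ∨
          u₁ + (if a.1 = j ∧ a.2 = true then 1 else 0) = x₁ ∧
          u₀ + (if a.1 = j ∧ a.2 = false then 1 else 0) = x₀ ∧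
          v₁ + (if a.1 ≠ j ∧ a.2 = true then 1 else 0) = y₁ ∧
          v₀ + (if a.1 ≠ j ∧ a.2 = false then 1 else 0) = y₀) →
        ∃ T ≤ a ::ₘ s, cntEq j true T = x₁ ∧ cntEq j false T = x₀ ∧ cntNe j true T = y₁ ∧
          cntNe j false T = y₀ := by
      intro u₁ u₀ v₁ v₀ h1 h2 h3 h4 h
      obtain ⟨T, hT, e1, e2, e3, e4⟩ := ih h1 h2 h3 h4
      rcases h with ⟨rfl, rfl, rfl, rfl⟩ | ⟨rfl, rfl, rfl, rfl⟩
      · exact ⟨T, hT.trans (Multiset.le_cons_self _ _), e1, e2, e3, e4⟩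
      · refine ⟨a ::ₘ T, Multiset.cons_le_cons _ hT, ?_, ?_, ?_, ?_⟩ <;>
          simp only [cntEq, cntNe, Multiset.countP_cons] at * <;> omega
    simp only [cntEq, cntNe, Multiset.countP_cons] at hx₁ hx₀ hy₁ hy₀ key
    simp only [cntEq, cntNe]
    rcases a with ⟨e, _ | _⟩ <;> obtain rfl | h := eq_or_ne j e <;>
      simp only [ne_eq, not_true_eq_false, not_false_eq_true, and_self, and_true, and_false,
        if_true, if_false, reduceCtorEq, add_zero, Ne.symm, *] at hx₁ hx₀ hy₁ hy₀ key ⊢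
    · by_cases h' : x₀ ≤ s.countP fun x => x.1 = j ∧ x.2 = false
      · exact key hx₁ h' hy₁ hy₀ (Or.inl (by simp))
      · exact key (u₀ := x₀ - 1) hx₁ (by omega) hy₁ hy₀ (Or.inr (by simp; omega))
    · by_cases h' : y₀ ≤ s.countP fun x => ¬ x.1 = j ∧ x.2 = false
      · exact key hx₁ hx₀ hy₁ h' (Or.inl (by simp))
      · exact key (v₀ := y₀ - 1) hx₁ hx₀ hy₁ (by omega) (Or.inr (by simp; omega))
    · by_cases h' : x₁ ≤ s.countP fun x => x.1 = j ∧ x.2 = true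
      · exact key h' hx₀ hy₁ hy₀ (Or.inl (by simp))
      · exact key (u₁ := x₁ - 1) (by omega) hx₀ hy₁ hy₀ (Or.inr (by simp; omega))
    · by_cases h' : y₁ ≤ s.countP fun x => ¬ x.1 = j ∧ x.2 = true
      · exact key hx₁ hx₀ h' hy₀ (Or.inl (by simp))
      · exact key (v₁ := y₁ - 1) hx₁ hx₀ (by omega) hy₀ (Or.inr (by simp; omega))

/-- Selecting an even positive number of elements of the least valuation `j < r`. -/
theorem exists_twoBalanced_of_cnt {j r : ℕ} (hjr : j < r) {M : Multiset (ℕ × Bool)}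
    (hM : ∀ x ∈ M, j ≤ x.1) {x₁ x₀ y₁ y₀ : ℕ}
    (hx₁ : x₁ ≤ cntEq j true M) (hx₀ : x₀ ≤ cntEq j false M)
    (hy₁ : y₁ ≤ cntNe j true M) (hy₀ : y₀ ≤ cntNe j false M)
    (hpos : 0 < x₁ + x₀) (heven : (x₁ + x₀) % 2 = 0) :
    ∃ T ≤ M, T.card = x₁ + x₀ + y₁ + y₀ ∧ TwoBalanced r T ∧
      T.countP (·.2 = true) = x₁ + y₁ := by
  obtain ⟨T, hT, rfl, rfl, rfl, rfl⟩ := exists_le_cnt j M hx₁ hx₀ hy₁ hy₀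
  exact ⟨T, hT, card_eq_cnt j T, Or.inr ⟨j, hjr, fun x hx => hM x (Multiset.mem_of_le hT hx),
    by rwa [countP_fst], by rwa [countP_fst]⟩, countP_snd j T⟩

theorem exists_twoBalanced_of_two_le {n j r : ℕ} (hn : n % 2 = 0) (hn2 : 2 ≤ n) (hjr : j < r)
    {M : Multiset (ℕ × Bool)} (hM : ∀ x ∈ M, j ≤ x.1) (hcard : n + 1 ≤ M.card)
    (h2 : 2 ≤ M.countP (·.1 = j)) : ∃ T ≤ M, T.card = n ∧ TwoBalanced r T := by
  rw [countP_fst] at h2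
  rw [card_eq_cnt j] at hcard
  obtain ⟨k, hk2, hk, hka, hkn, hkb⟩ : ∃ k, 2 ≤ k ∧ k % 2 = 0 ∧
      k ≤ cntEq j true M + cntEq j false M ∧ k ≤ n ∧
      n - k ≤ cntNe j true M + cntNe j false M := by
    by_cases h : n ≤ cntEq j true M + cntEq j false M
    · exact ⟨n, by omega⟩
    · exact ⟨(cntEq j true M + cntEq j false M) / 2 * 2, by omega⟩
  obtain ⟨T, hT, hc, hb, -⟩ := exists_twoBalanced_of_cnt hjr hM
    (x₁ := min k (cntEq j true M)) (x₀ := k - min k (cntEq j true M))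
    (y₁ := min (n - k) (cntNe j true M)) (y₀ := n - k - min (n - k) (cntNe j true M))
    (by omega) (by omega) (by omega) (by omega) (by omega) (by omega)
  exact ⟨T, hT, by omega, hb⟩

theorem exists_cons_of_countP_eq_one {j : ℕ} {M : Multiset (ℕ × Bool)} (hM : ∀ x ∈ M, j ≤ x.1)
    (h : M.countP (·.1 = j) = 1) : ∃ b M', M = (j, b) ::ₘ M' ∧ ∀ x ∈ M', j + 1 ≤ x.1 := by
  obtain ⟨⟨e, b⟩, hx, rfl⟩ := Multiset.countP_pos.1 (by omega : 0 < M.countP (·.1 = j))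
  obtain ⟨M', rfl⟩ := Multiset.exists_cons_of_mem hx
  refine ⟨b, M', rfl, fun y hy => ?_⟩
  have h0 : M'.countP (·.1 = e) = 0 := by simpa [Multiset.countP_cons] using h
  have := Multiset.countP_eq_zero.1 h0 y hy
  have := hM y (Multiset.mem_cons_of_mem hy)
  simp only at *
  omega

theorem succ_le_of_countP_eq_zero {j : ℕ} {M : Multiset (ℕ × Bool)} (hM : ∀ x ∈ M, j ≤ x.1)
    (h : M.countP (·.1 = j) = 0) : ∀ x ∈ M, j + 1 ≤ x.1 := fun x hx => by
  have := Multiset.countP_eq_zero.1 h x hx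
  have := hM x hx
  omega

theorem exists_twoBalanced {n : ℕ} (hn : n % 2 = 0) (hn2 : 2 ≤ n) (d : ℕ) :
    ∀ {j r : ℕ}, r = j + d → ∀ {M : Multiset (ℕ × Bool)}, (∀ x ∈ M, j ≤ x.1) →
      (∀ x ∈ M, x.1 ≤ r) → n + d ≤ M.card → ∃ T ≤ M, T.card = n ∧ TwoBalanced r T := by
  induction d with
  | zero =>
    intro j r hr M hM hM' hc
    obtain ⟨T, hT, hTc⟩ := Multiset.exists_le_card_eq_of_le (by omega : n ≤ M.card)
    refine ⟨T, hT, hTc, Or.inl fun x hx => ?_⟩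
    have h1 := hM x (Multiset.mem_of_le hT hx)
    have h2 := hM' x (Multiset.mem_of_le hT hx)
    omega
  | succ d ih =>
    intro j r hr M hM hM' hc
    rcases (by omega : M.countP (·.1 = j) = 0 ∨ M.countP (·.1 = j) = 1 ∨
      2 ≤ M.countP (·.1 = j)) with h | h | h
    · exact ih (by omega : r = j + 1 + d) (succ_le_of_countP_eq_zero hM h) hM' (by omega)
    · obtain ⟨b, M', rfl, hM1⟩ := exists_cons_of_countP_eq_one hM h
      rw [Multiset.card_cons] at hc
      obtain ⟨T, hT, h⟩ := ih (by omega : r = j + 1 + d) hM1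
        (fun x hx => hM' x (Multiset.mem_cons_of_mem hx)) (by omega)
      exact ⟨T, hT.trans (Multiset.le_cons_self _ _), h⟩
    · exact exists_twoBalanced_of_two_le hn hn2 (by omega) hM (by omega) h

theorem eq_replicate_of_fst {R : ℕ} {M : Multiset (ℕ × Bool)} (hM : ∀ x ∈ M, R ≤ x.1)
    (hM' : ∀ x ∈ M, x.1 ≤ R + 1) :
    M = Multiset.replicate (cntEq R true M) (R, true) +
      Multiset.replicate (cntEq R false M) (R, false) +
      Multiset.replicate (cntNe R true M) (R + 1, true) +
      Multiset.replicate (cntNe R false M) (R + 1, false) := by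
  induction M using Multiset.induction_on with
  | empty => simp [cntEq, cntNe]
  | cons a s ih =>
    have ih := ih (fun x hx => hM x (Multiset.mem_cons_of_mem hx))
      (fun x hx => hM' x (Multiset.mem_cons_of_mem hx))
    have h1 := hM a (Multiset.mem_cons_self _ _)
    have h2 := hM' a (Multiset.mem_cons_self _ _)
    rcases a with ⟨e, _ | _⟩ <;>
      rcases (by simp only at h1 h2; omega : e = R ∨ e = R + 1) with rfl | rfl <;>
    · conv_lhs => rw [ih]
      simp [cntEq, cntNe, Multiset.replicate_succ]

/-- The elements `(i, g i)` for `j ≤ i < R`. -/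
def ladder (g : ℕ → Bool) (j R : ℕ) : Multiset (ℕ × Bool) :=
  (Finset.Ico j R).val.map fun i => (i, g i)

theorem ladder_self (g : ℕ → Bool) (R : ℕ) : ladder g R R = 0 := by simp [ladder]

theorem ladder_eq_cons (g : ℕ → Bool) {j R : ℕ} (h : j < R) :
    ladder g j R = (j, g j) ::ₘ ladder g (j + 1) R := by
  rw [ladder, ← Finset.insert_Ico_add_one_left_eq_Ico h, Finset.insert_val_of_notMem (by simp),
    Multiset.map_cons, ladder]

theorem cons_ladder (g : ℕ → Bool) (b : Bool) {j R : ℕ} (h : j < R) :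
    (j, b) ::ₘ ladder g (j + 1) R = ladder (Function.update g j b) j R := by
  rw [ladder_eq_cons _ h, Function.update_self]
  congr 1
  refine Multiset.map_congr rfl fun i hi => ?_
  have : i ≠ j := by have := Finset.mem_Ico.1 (show i ∈ Finset.Ico (j + 1) R from hi); omega
  rw [Function.update_of_ne this]

theorem eq_ladder_of_not_twoBalanced {n : ℕ} (hn : n % 2 = 0) (hn2 : 2 ≤ n) {R : ℕ} (d : ℕ) :
    ∀ {j : ℕ}, R = j + d → ∀ {M : Multiset (ℕ × Bool)}, (∀ x ∈ M, j ≤ x.1) →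
      (∀ x ∈ M, x.1 ≤ R + 1) → (∀ x ∈ M, x.2 = false) → M.card = n + d →
      (¬ ∃ T ≤ M, T.card = n ∧ TwoBalanced (R + 1) T) →
      ∃ m, m % 2 = 1 ∧ m ≤ n ∧ M = ladder (fun _ => false) j R +
        (Multiset.replicate m (R, false) + Multiset.replicate (n - m) (R + 1, false)) := by
  induction d with
  | zero =>
    intro j hj M hM hM' hz hc hbad
    obtain rfl : R = j := by omega
    have e := eq_replicate_of_fst hM hM'
    have hz1 : cntEq R true M = 0 := Multiset.countP_eq_zero.2 fun x hx => by simp [hz x hx]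
    have hz2 : cntNe R true M = 0 := Multiset.countP_eq_zero.2 fun x hx => by simp [hz x hx]
    have hc' := card_eq_cnt R M
    rw [hz1, hz2] at e hc'
    refine ⟨cntEq R false M, ?_, by omega, ?_⟩
    · by_contra hodd
      refine hbad ⟨M, le_rfl, hc, ?_⟩
      have hcount := countP_fst R M
      rw [hz1] at hcount
      by_cases h0 : M.countP (·.1 = R) = 0
      · refine Or.inl fun x hx => le_antisymm (hM' x hx) (succ_le_of_countP_eq_zero hM h0 x hx)
      · exact Or.inr ⟨R, by omega, hM, by omega, by omega⟩
    · rw [show n - cntEq R false M = cntNe R false M by omega]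
      simpa [ladder_self] using e
  | succ d ih =>
    intro j hj M hM hM' hz hc hbad
    rcases (by omega : M.countP (·.1 = j) = 0 ∨ M.countP (·.1 = j) = 1 ∨
      2 ≤ M.countP (·.1 = j)) with h | h | h
    · exact absurd (exists_twoBalanced hn hn2 (d + 1) (by omega : R + 1 = j + 1 + (d + 1))
        (succ_le_of_countP_eq_zero hM h) hM' (by omega)) hbad
    · obtain ⟨b, M', rfl, hM1⟩ := exists_cons_of_countP_eq_one hM h
      rw [Multiset.card_cons] at hc
      obtain ⟨m, hm, hmn, e⟩ := ih (by omega : R = j + 1 + d) hM1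
        (fun x hx => hM' x (Multiset.mem_cons_of_mem hx))
        (fun x hx => hz x (Multiset.mem_cons_of_mem hx)) (by omega)
        (fun ⟨T, hT, h⟩ => hbad ⟨T, hT.trans (Multiset.le_cons_self _ _), h⟩)
      have hb : b = false := hz _ (Multiset.mem_cons_self _ _)
      refine ⟨m, hm, hmn, ?_⟩
      rw [ladder_eq_cons _ (by omega : j < R), Multiset.cons_add, ← e, hb]
    · exact absurd (exists_twoBalanced_of_two_le hn hn2 (by omega) hM (by omega) h) hbad

/-- Numerical core: with at least two spare elements, a balanced selection exists unless the least
valuation class consists of one element of each kind and all the others are zero modulo `p`. -/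
theorem cnt_of_forall_selection {n a₁ a₀ b₁ b₀ : ℕ} (hn : n % 2 = 0) (hn4 : 4 ≤ n)
    (h2 : 2 ≤ a₁ + a₀) (hN : n + 2 ≤ a₁ + a₀ + b₁ + b₀)
    (h : ∀ x₁ x₀ y₁ y₀, x₁ ≤ a₁ → x₀ ≤ a₀ → y₁ ≤ b₁ → y₀ ≤ b₀ → 0 < x₁ + x₀ →
      (x₁ + x₀) % 2 = 0 → x₁ + x₀ + y₁ + y₀ = n → x₁ + y₁ = 1) :
    a₁ = 1 ∧ a₀ = 1 ∧ b₁ = 0 := by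
  obtain ⟨x₁, x₀, y₁, y₀, h1, h2, h3, h4, h5, h6, h7⟩ : ∃ x₁ x₀ y₁ y₀, x₁ ≤ a₁ ∧ x₀ ≤ a₀ ∧
      y₁ ≤ b₁ ∧ y₀ ≤ b₀ ∧ 0 < x₁ + x₀ ∧ (x₁ + x₀) % 2 = 0 ∧ x₁ + x₀ + y₁ + y₀ = n := by
    obtain ⟨k, hk2, hk, hka, hkn, hkb⟩ : ∃ k, 2 ≤ k ∧ k % 2 = 0 ∧ k ≤ a₁ + a₀ ∧ k ≤ n ∧
        n - k ≤ b₁ + b₀ := by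
      by_cases h : n ≤ a₁ + a₀
      · exact ⟨n, by omega⟩
      · exact ⟨(a₁ + a₀) / 2 * 2, by omega⟩
    exact ⟨min k a₁, k - min k a₁, min (n - k) b₁, n - k - min (n - k) b₁, by omega⟩
  have h8 := h _ _ _ _ h1 h2 h3 h4 h5 h6 h7
  rcases (by omega : x₁ = 1 ∧ y₁ = 0 ∨ x₁ = 0 ∧ y₁ = 1) with ⟨rfl, rfl⟩ | ⟨rfl, rfl⟩
  · have e1 : x₀ = a₀ := by
      by_contra hne
      have := h 0 (x₀ + 1) 0 y₀ (by omega) (by omega) (by omega) (by omega) (by omega) (by omega)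
        (by omega)
      omega
    have e2 : a₁ = 1 := by
      by_contra hne
      have := h 2 (x₀ - 1) 0 y₀ (by omega) (by omega) (by omega) (by omega) (by omega) (by omega)
        (by omega)
      omega
    by_cases hb : b₁ = 0
    · refine ⟨e2, ?_, hb⟩
      by_contra hne
      have := h 0 (x₀ - 1) 0 (y₀ + 2) (by omega) (by omega) (by omega) (by omega) (by omega)
        (by omega) (by omega)
      omega
    · exfalso
      have e3 : y₀ = 0 := by
        by_contra hne
        have := h 1 x₀ 1 (y₀ - 1) (by omega) (by omega) (by omega) (by omega) (by omega)
          (by omega) (by omega)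
        omega
      have := h 1 (x₀ - 2) (min b₁ 2) (2 - min b₁ 2) (by omega) (by omega) (by omega) (by omega)
        (by omega) (by omega) (by omega)
      omega
  · exfalso
    have e1 : a₁ = 0 := by
      by_contra hne
      have := h 1 (x₀ - 1) 1 y₀ (by omega) (by omega) (by omega) (by omega) (by omega) (by omega)
        (by omega)
      omega
    have e2 : y₀ = b₀ := by
      by_contra hne
      have := h 0 x₀ 0 (y₀ + 1) (by omega) (by omega) (by omega) (by omega) (by omega) (by omega)
        (by omega)
      omega
    have e3 : b₁ = 1 := by
      by_contra hne
      have := h 0 x₀ 2 (y₀ - 1) (by omega) (by omega) (by omega) (by omega) (by omega) (by omega)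
        (by omega)
      omega
    have := h 0 (x₀ + 2) 0 (y₀ - 1) (by omega) (by omega) (by omega) (by omega) (by omega)
      (by omega) (by omega)
    omega

/-- Numerical core for the two top valuations, where exactly one element has to be left out. -/
theorem cnt_of_forall_selection_of_card_eq {n a₁ a₀ b₁ b₀ : ℕ} (hn : n % 2 = 0) (hn4 : 4 ≤ n)
    (hN : a₁ + a₀ + b₁ + b₀ = n + 1)
    (h : ∀ x₁ x₀ y₁ y₀, x₁ ≤ a₁ → x₀ ≤ a₀ → y₁ ≤ b₁ → y₀ ≤ b₀ →
      (x₁ + x₀) % 2 = 0 → x₁ + x₀ + y₁ + y₀ = n → x₁ + y₁ = 1) :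
    (a₁ = 1 ∧ a₀ = n - 1 ∧ b₁ = 1 ∧ b₀ = 0) ∨
      (a₁ = 1 ∧ b₁ = 0 ∧ a₀ % 2 = 1 ∧ a₀ ≤ n ∧ b₀ = n - a₀) ∨
      (a₁ = 1 ∧ a₀ = 0 ∧ b₁ = 1 ∧ b₀ = n - 1) ∨
      (a₁ = 0 ∧ b₁ = 1 ∧ a₀ % 2 = 1 ∧ a₀ ≤ n ∧ b₀ = n - a₀) := by
  rcases Nat.mod_two_eq_zero_or_one (a₁ + a₀) with ha | ha
  · have s1 : 1 ≤ b₁ → a₁ + (b₁ - 1) = 1 := fun hb =>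
      h a₁ a₀ (b₁ - 1) b₀ le_rfl le_rfl (by omega) le_rfl ha (by omega)
    have s2 : 1 ≤ b₀ → a₁ + b₁ = 1 := fun hb =>
      h a₁ a₀ b₁ (b₀ - 1) le_rfl le_rfl le_rfl (by omega) ha (by omega)
    rcases Nat.eq_zero_or_pos b₁ with hb | hb
    · have := s2 (by omega)
      exact Or.inr (Or.inl (by omega))
    · have := s1 hb
      rcases Nat.eq_zero_or_pos b₀ with hb' | hb'
      · exact Or.inl (by omega)
      · have := s2 hb'
        exfalso
        omega
  · have s1 : 1 ≤ a₁ → a₁ - 1 + b₁ = 1 := fun hb =>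
      h (a₁ - 1) a₀ b₁ b₀ (by omega) le_rfl le_rfl le_rfl (by omega) (by omega)
    have s2 : 1 ≤ a₀ → a₁ + b₁ = 1 := fun hb =>
      h a₁ (a₀ - 1) b₁ b₀ le_rfl (by omega) le_rfl le_rfl (by omega) (by omega)
    rcases Nat.eq_zero_or_pos a₁ with hb | hb
    · have := s2 (by omega)
      exact Or.inr (Or.inr (Or.inr (by omega)))
    · have := s1 hb
      rcases Nat.eq_zero_or_pos a₀ with hb' | hb'
      · exact Or.inr (Or.inr (Or.inl (by omega)))
      · have := s2 hb'
        exfalso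
        omega

theorem cnt_of_not_hasBalanced {n j r : ℕ} (hn : n % 2 = 0) (hn4 : 4 ≤ n) (hjr : j < r)
    {M : Multiset (ℕ × Bool)} (hM : ∀ x ∈ M, j ≤ x.1) (hc : n + 2 ≤ M.card)
    (h2 : 2 ≤ M.countP (·.1 = j)) (hbad : ¬ HasBalanced n r M) :
    ∃ M', M = (j, true) ::ₘ (j, false) ::ₘ M' ∧ (∀ x ∈ M', j + 1 ≤ x.1) ∧
      ∀ x ∈ M', x.2 = false := by
  rw [card_eq_cnt j] at hc
  rw [countP_fst] at h2
  obtain ⟨e1, e2, e3⟩ := cnt_of_forall_selection hn hn4 h2 hc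
    fun x₁ x₀ y₁ y₀ h1 h2 h3 h4 h5 h6 h7 => by
      by_contra hne
      obtain ⟨T, hT, hTc, hb, hs⟩ := exists_twoBalanced_of_cnt hjr hM h1 h2 h3 h4 h5 h6
      exact hbad ⟨T, hT, by omega, hb, by omega⟩
  obtain ⟨⟨e, b⟩, hx, rfl, rfl⟩ := Multiset.countP_pos.1 (by rw [← cntEq]; omega :
    0 < M.countP fun x => x.1 = j ∧ x.2 = true)
  obtain ⟨M₁, rfl⟩ := Multiset.exists_cons_of_mem hx
  have e2' : cntEq e false M₁ = 1 := by simpa [cntEq] using e2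
  obtain ⟨⟨e', b⟩, hx', h', rfl⟩ := Multiset.countP_pos.1 (by rw [← cntEq]; omega :
    0 < M₁.countP fun x => x.1 = e ∧ x.2 = false)
  obtain rfl : e' = e := h'
  obtain ⟨M, rfl⟩ := Multiset.exists_cons_of_mem hx'
  have f1 : cntEq e' true M = 0 := by simpa [cntEq] using e1
  have f2 : cntEq e' false M = 0 := by simpa [cntEq] using e2'
  have f3 : cntNe e' true M = 0 := by simpa [cntNe] using e3
  refine ⟨M, rfl, succ_le_of_countP_eq_zero (fun x hx => hM x (by simp [hx])) ?_, fun x hx => ?_⟩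
  · change M.countP (·.1 = e') = 0
    rw [countP_fst]; omega
  · have : M.countP (·.2 = true) = 0 := by rw [countP_snd e']; omega
    simpa using Multiset.countP_eq_zero.1 this x hx

theorem hasBalanced_of_forall_snd_eq_false {n r : ℕ} {M N : Multiset (ℕ × Bool)}
    (hMN : M ≤ N) (hz : ∀ x ∈ M, x.2 = false) (h : ∃ T ≤ M, T.card = n ∧ TwoBalanced r T) :
    HasBalanced n r N := by
  obtain ⟨T, hT, hc, hb⟩ := h
  refine ⟨T, hT.trans hMN, hc, hb, ?_⟩
  rw [Multiset.countP_eq_zero.2 fun x hx => by simp [hz x (Multiset.mem_of_le hT hx)]]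
  omega

theorem hasBalanced_of_card {n : ℕ} (hn : n % 2 = 0) (hn4 : 4 ≤ n) (d : ℕ) :
    ∀ {j r : ℕ}, r = j + d → ∀ {M : Multiset (ℕ × Bool)}, (∀ x ∈ M, j ≤ x.1) →
      (∀ x ∈ M, x.1 ≤ r) → n + d + 1 ≤ M.card → HasBalanced n r M := by
  induction d with
  | zero =>
    intro j r hr M hM hM' hc
    have hE : ∀ x ∈ M, x.1 = r := fun x hx => le_antisymm (hM' x hx) (by have := hM x hx; omega)
    have h0 : ∀ b, cntNe r b M = 0 := fun b =>
      Multiset.countP_eq_zero.2 fun x hx => by simp [hE x hx]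
    rw [card_eq_cnt r, h0, h0] at hc
    obtain ⟨x₁, x₀, h1, h2, h3, h4⟩ : ∃ x₁ x₀, x₁ ≤ cntEq r true M ∧ x₀ ≤ cntEq r false M ∧
        x₁ + x₀ = n ∧ x₁ ≠ 1 := by
      by_cases h : 2 ≤ cntEq r true M
      · exact ⟨min n (cntEq r true M), n - min n (cntEq r true M), by omega⟩
      · exact ⟨0, n, by omega⟩
    obtain ⟨T, hT, rfl, rfl, h5, h6⟩ := exists_le_cnt r M h1 h2 (Nat.zero_le _) (Nat.zero_le _)
    refine ⟨T, hT, ?_, Or.inl fun x hx => hE x (Multiset.mem_of_le hT hx), ?_⟩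
    · rw [card_eq_cnt r]; omega
    · rw [countP_snd r]; omega
  | succ d ih =>
    intro j r hr M hM hM' hc
    rcases (by omega : M.countP (·.1 = j) = 0 ∨ M.countP (·.1 = j) = 1 ∨
      2 ≤ M.countP (·.1 = j)) with h | h | h
    · exact ih (by omega : r = j + 1 + d) (succ_le_of_countP_eq_zero hM h) hM' (by omega)
    · obtain ⟨b, M', rfl, hM1⟩ := exists_cons_of_countP_eq_one hM h
      rw [Multiset.card_cons] at hc
      exact (ih (by omega : r = j + 1 + d) hM1
        (fun x hx => hM' x (Multiset.mem_cons_of_mem hx)) (by omega)).mono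
        (Multiset.le_cons_self _ _)
    · by_contra hbad
      obtain ⟨M', rfl, hM1, hz⟩ := cnt_of_not_hasBalanced hn hn4 (by omega) hM (by omega) h hbad
      simp only [Multiset.card_cons] at hc
      exact hbad (hasBalanced_of_forall_snd_eq_false
        ((Multiset.le_cons_self _ _).trans (Multiset.le_cons_self _ _)) hz
        (exists_twoBalanced hn (by omega) d (by omega : r = j + 1 + d) hM1
          (fun x hx => hM' x (by simp [hx])) (by omega)))

/-- The three shapes of maximal type multisets without balanced sub-multiset of size `n`. -/
def IsExtremalShape (n j R : ℕ) (M : Multiset (ℕ × Bool)) : Prop :=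
  (∃ g t v m, t ≤ R ∧ t ≤ v ∧ v ≤ R + 1 ∧ j ≤ t ∧ (∀ i, t ≤ i → g i = false) ∧ m % 2 = 1 ∧
    m ≤ n ∧ M = ladder g j R + ((v, true) ::ₘ
      (Multiset.replicate m (R, false) + Multiset.replicate (n - m) (R + 1, false)))) ∨
  (∃ g, M = ladder g j R + ((R, true) ::ₘ (R + 1, true) ::ₘ
    Multiset.replicate (n - 1) (R + 1, false))) ∨
  (∃ g, M = ladder g j R + ((R + 1, true) ::ₘ (R, true) ::ₘ
    Multiset.replicate (n - 1) (R, false)))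

theorem IsExtremalShape.cons {n j R : ℕ} {M : Multiset (ℕ × Bool)} (hj : j < R)
    (h : IsExtremalShape n (j + 1) R M) (b : Bool) : IsExtremalShape n j R ((j, b) ::ₘ M) := by
  rcases h with ⟨g, t, v, m, h1, h2, h3, h4, h5, h6, h7, rfl⟩ | ⟨g, rfl⟩ | ⟨g, rfl⟩
  · refine Or.inl ⟨Function.update g j b, t, v, m, h1, h2, h3, by omega, fun i hi => ?_, h6, h7, ?_⟩
    · rw [Function.update_of_ne (by omega), h5 i hi]
    · rw [← cons_ladder g b hj, Multiset.cons_add]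
  · exact Or.inr (Or.inl ⟨Function.update g j b, by rw [← cons_ladder g b hj, Multiset.cons_add]⟩)
  · exact Or.inr (Or.inr ⟨Function.update g j b, by rw [← cons_ladder g b hj, Multiset.cons_add]⟩)

theorem isExtremalShape_of_not_hasBalanced {n : ℕ} (hn : n % 2 = 0) (hn4 : 4 ≤ n) {R : ℕ} (d : ℕ) :
    ∀ {j : ℕ}, R = j + d → ∀ {M : Multiset (ℕ × Bool)}, (∀ x ∈ M, j ≤ x.1) →
      (∀ x ∈ M, x.1 ≤ R + 1) → M.card = n + d + 1 → ¬ HasBalanced n (R + 1) M →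
      IsExtremalShape n j R M := by
  induction d with
  | zero =>
    intro R' hj M hM hM' hc hbad
    obtain ⟨j, rfl, rfl⟩ : ∃ j, j = R ∧ j = R' := ⟨R, rfl, by omega⟩
    rw [add_zero] at hc
    have e := eq_replicate_of_fst hM hM'
    rw [card_eq_cnt j] at hc
    have sel : ∀ x₁ x₀ y₁ y₀, x₁ ≤ cntEq j true M → x₀ ≤ cntEq j false M → y₁ ≤ cntNe j true M →
        y₀ ≤ cntNe j false M → (x₁ + x₀) % 2 = 0 → x₁ + x₀ + y₁ + y₀ = n → x₁ + y₁ = 1 := by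
      intro x₁ x₀ y₁ y₀ h1 h2 h3 h4 h6 h7
      by_contra hne
      by_cases h0 : x₁ + x₀ = 0
      · obtain ⟨T, hT, g1, g2, g3, g4⟩ := exists_le_cnt j M h1 h2 h3 h4
        refine hbad ⟨T, hT, ?_, Or.inl ?_, ?_⟩
        · rw [card_eq_cnt j]; omega
        · have hz : T.countP (·.1 = j) = 0 := by rw [countP_fst]; omega
          exact fun x hx => le_antisymm (hM' x (Multiset.mem_of_le hT hx))
            (succ_le_of_countP_eq_zero (fun x hx => hM x (Multiset.mem_of_le hT hx)) hz x hx)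
        · rw [countP_snd j]; omega
      · obtain ⟨T, hT, hTc, hb, hs⟩ :=
          exists_twoBalanced_of_cnt (by omega : j < j + 1) hM h1 h2 h3 h4 (by omega) h6
        exact hbad ⟨T, hT, by omega, hb, by omega⟩
    generalize cntEq j true M = a₁ at *
    generalize cntEq j false M = a₀ at *
    generalize cntNe j true M = b₁ at *
    generalize cntNe j false M = b₀ at *
    rcases cnt_of_forall_selection_of_card_eq hn hn4 hc sel with
      ⟨rfl, rfl, rfl, rfl⟩ | ⟨rfl, rfl, h1, h2, rfl⟩ | ⟨rfl, rfl, rfl, rfl⟩ |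
        ⟨rfl, rfl, h1, h2, rfl⟩
    · refine Or.inr (Or.inr ⟨fun _ => false, ?_⟩)
      rw [e, ladder_self, ← Multiset.singleton_add, ← Multiset.singleton_add (j, true)]
      simp only [Multiset.replicate_one, Multiset.replicate_zero]
      abel
    · refine Or.inl ⟨fun _ => false, j, j, a₀, by omega, by omega, by omega, le_rfl, by simp, h1,
        h2, ?_⟩
      rw [e, ladder_self, ← Multiset.singleton_add]
      simp only [Multiset.replicate_one, Multiset.replicate_zero]
      abel
    · refine Or.inr (Or.inl ⟨fun _ => false, ?_⟩)
      rw [e, ladder_self, ← Multiset.singleton_add, ← Multiset.singleton_add (j + 1, true)]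
      simp only [Multiset.replicate_one, Multiset.replicate_zero]
      abel
    · refine Or.inl ⟨fun _ => false, j, j + 1, a₀, by omega, by omega, by omega, le_rfl, by simp,
        h1, h2, ?_⟩
      rw [e, ladder_self, ← Multiset.singleton_add]
      simp only [Multiset.replicate_one, Multiset.replicate_zero]
      abel
  | succ d ih =>
    intro j hj M hM hM' hc hbad
    rcases (by omega : M.countP (·.1 = j) = 0 ∨ M.countP (·.1 = j) = 1 ∨
      2 ≤ M.countP (·.1 = j)) with h | h | h
    · exact absurd (hasBalanced_of_card hn hn4 (d + 1) (by omega : R + 1 = j + 1 + (d + 1))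
        (succ_le_of_countP_eq_zero hM h) hM' (by omega)) hbad
    · obtain ⟨b, M', rfl, hM1⟩ := exists_cons_of_countP_eq_one hM h
      rw [Multiset.card_cons] at hc
      exact (ih (by omega : R = j + 1 + d) hM1
        (fun x hx => hM' x (Multiset.mem_cons_of_mem hx)) (by omega)
        fun h => hbad (h.mono (Multiset.le_cons_self _ _))).cons (by omega) b
    · obtain ⟨M', rfl, hM1, hz⟩ := cnt_of_not_hasBalanced hn hn4 (by omega) hM (by omega) h hbad
      simp only [Multiset.card_cons] at hc
      obtain ⟨m, hm, hmn, rfl⟩ := eq_ladder_of_not_twoBalanced hn (by omega) d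
        (by omega : R = j + 1 + d) hM1 (fun x hx => hM' x (by simp [hx])) hz (by omega)
        fun h => hbad (hasBalanced_of_forall_snd_eq_false
          ((Multiset.le_cons_self _ _).trans (Multiset.le_cons_self _ _)) hz h)
      refine Or.inl ⟨fun _ => false, j, j, m, by omega, le_rfl, by omega, le_rfl, by simp, hm,
        hmn, ?_⟩
      rw [ladder_eq_cons _ (by omega : j < R), Multiset.cons_add, Multiset.add_cons,
        Multiset.cons_swap]

/-! ### Weighted zero-sums of multisets -/

/-- A multiset becomes zero-sum after multiplying its members by suitable units. -/
def IsUnitZeroSum {R : Type*} [CommRing R] (T : Multiset R) : Prop :=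
  ∃ T', Multiset.Rel Associated T T' ∧ T'.sum = 0

theorem Multiset.Rel.associated_symm {R : Type*} [CommRing R] {S T : Multiset R}
    (h : Multiset.Rel Associated S T) : Multiset.Rel Associated T S :=
  Multiset.rel_flip.1 (h.mono fun _ _ _ _ h => Associated.symm h)

theorem Multiset.Rel.associated_trans {R : Type*} [CommRing R] {S T W : Multiset R}
    (h : Multiset.Rel Associated S T) (h' : Multiset.Rel Associated T W) :
    Multiset.Rel Associated S W := by
  have : IsTrans R Associated := ⟨fun _ _ _ => Associated.trans⟩
  exact Multiset.Rel.trans _ h h'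

theorem IsUnitZeroSum.of_rel {R : Type*} [CommRing R] {S T : Multiset R} (hS : IsUnitZeroSum S)
    (h : Multiset.Rel Associated S T) : IsUnitZeroSum T := by
  obtain ⟨T', h', hs⟩ := hS
  exact ⟨T', h.associated_symm.associated_trans h', hs⟩

theorem rel_associated_zipWith {n : ℕ} (S : List (ZMod n)) :
    ∀ w : List (ZMod n), w.length = S.length → (∀ a ∈ w, a ∈ U n) →
      Multiset.Rel Associated (S : Multiset (ZMod n))
        (List.zipWith (· * ·) w S : List (ZMod n)) := by
  induction S with
  | nil => intro w _ _; simp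
  | cons x S ih =>
    intro w hw hU
    obtain _ | ⟨a, w⟩ := w
    · simp at hw
    · rw [List.zipWith_cons_cons, ← Multiset.cons_coe, ← Multiset.cons_coe]
      refine Multiset.Rel.cons ?_ (ih w (by simpa using hw) fun b hb => hU b (by simp [hb]))
      obtain ⟨u, hu⟩ : IsUnit a := hU a (by simp)
      exact ⟨u, by rw [hu, mul_comm]⟩

theorem exists_zipWith_of_rel_associated {n : ℕ} (S : List (ZMod n)) :
    ∀ M : Multiset (ZMod n), Multiset.Rel Associated (S : Multiset (ZMod n)) M →
      ∃ w : List (ZMod n), w.length = S.length ∧ (∀ a ∈ w, a ∈ U n) ∧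
        M = (List.zipWith (· * ·) w S : List (ZMod n)) := by
  induction S with
  | nil => intro M h; exact ⟨[], by simpa using h⟩
  | cons x S ih =>
    intro M h
    rw [← Multiset.cons_coe, Multiset.rel_cons_left] at h
    obtain ⟨y, M', ⟨u, rfl⟩, hM', rfl⟩ := h
    obtain ⟨w, hw, hU, rfl⟩ := ih M' hM'
    refine ⟨(u : ZMod n) :: w, by simpa using hw, ?_, ?_⟩
    · intro a ha
      rcases List.mem_cons.1 ha with rfl | ha
      · exact u.isUnit
      · exact hU a ha
    · rw [List.zipWith_cons_cons, ← Multiset.cons_coe, mul_comm]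

theorem isWZSum_iff {n : ℕ} (T : List (ZMod n)) :
    IsWZSum (U n) T ↔ IsUnitZeroSum (T : Multiset (ZMod n)) := by
  constructor
  · rintro ⟨w, hw, hU, hs⟩
    exact ⟨_, rel_associated_zipWith T w hw hU, by rwa [Multiset.sum_coe]⟩
  · rintro ⟨T', h, hs⟩
    obtain ⟨w, hw, hU, rfl⟩ := exists_zipWith_of_rel_associated T T' h
    exact ⟨w, hw, hU, by rwa [Multiset.sum_coe] at hs⟩

/-- `S` contains a sub-multiset of size `n` which is zero-sum up to units. -/
def HasUnitZeroSum {R : Type*} [CommRing R] (S : Multiset R) (n : ℕ) : Prop :=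
  ∃ T ≤ S, T.card = n ∧ IsUnitZeroSum T

theorem hasWZSS_iff {n t : ℕ} (ht : 0 < t) (S : List (ZMod n)) :
    HasWZSS (U n) S t ↔ HasUnitZeroSum (S : Multiset (ZMod n)) t := by
  constructor
  · rintro ⟨-, T, hT, hc, hz⟩
    exact ⟨T, hT.subperm, by simpa using hc, (isWZSum_iff T).1 hz⟩
  · rintro ⟨T, hT, hc, hz⟩
    induction T using Quotient.inductionOn with
    | _ l =>
    obtain ⟨l', hl', hs⟩ := (Multiset.coe_le.1 hT : l.Subperm S)
    have e : (l' : Multiset (ZMod n)) = l := Multiset.coe_eq_coe.2 hl'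
    refine ⟨ht, l', hs, ?_, (isWZSum_iff l').2 ?_⟩
    · rw [hl'.length_eq]; simpa using hc
    · rw [e]; exact hz

theorem HasUnitZeroSum.of_rel {R : Type*} [CommRing R] {S F : Multiset R} {n : ℕ}
    (hS : HasUnitZeroSum S n) (h : Multiset.Rel Associated S F) : HasUnitZeroSum F n := by
  obtain ⟨T, hT, hc, hz⟩ := hS
  obtain ⟨W, rfl⟩ := Multiset.le_iff_exists_add.1 hT
  obtain ⟨T', W', h1, h2, rfl⟩ := Multiset.rel_add_left.1 h
  exact ⟨T', Multiset.le_add_right _ _, by rw [← Multiset.card_eq_card_of_rel h1, hc],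
    hz.of_rel h1⟩

theorem aEquiv_iff {n : ℕ} (S F : List (ZMod n)) :
    AEquiv (U n) S F ↔
      Multiset.Rel Associated (S : Multiset (ZMod n)) (F : Multiset (ZMod n)) := by
  constructor
  · rintro ⟨c, hc, w, hw, hU, hp⟩
    have h := rel_associated_zipWith S w hw hU
    rw [← Multiset.coe_eq_coe.2 hp, ← Multiset.map_coe] at h
    refine h.associated_trans (Multiset.rel_map_left.2 (Multiset.rel_refl_of_refl_on ?_))
    intro x _
    obtain ⟨u, rfl⟩ := hc
    exact Associated.symm ⟨u, mul_comm _ _⟩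
  · intro h
    obtain ⟨w, hw, hU, e⟩ := exists_zipWith_of_rel_associated S _ h
    refine ⟨1, isUnit_one, w, hw, hU, ?_⟩
    simpa using Multiset.coe_eq_coe.1 e

/-! ### Obstructions to zero-sums -/

theorem dvd_iff_of_associated {R : Type*} [CommRing R] {D x y : R} (h : Associated x y) :
    D ∣ x ↔ D ∣ y :=
  ⟨fun hx => hx.trans h.dvd, fun hy => hy.trans h.symm.dvd⟩

theorem IsUnitZeroSum.le_of_le_cons {R : Type*} [CommRing R] {D x : R} {S T : Multiset R}
    (hT : IsUnitZeroSum T) (hle : T ≤ x ::ₘ S) (hx : ¬ D ∣ x) (hS : ∀ y ∈ S, D ∣ y) : T ≤ S := by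
  classical
  by_cases hxT : x ∈ T
  · exfalso
    obtain ⟨T₁, rfl⟩ := Multiset.exists_cons_of_mem hxT
    have hT₁ : T₁ ≤ S := (Multiset.cons_le_cons_iff _).1 hle
    obtain ⟨T', h, hs⟩ := hT
    obtain ⟨y, T'', hy, hT'', rfl⟩ := Multiset.rel_cons_left.1 h
    rw [Multiset.sum_cons] at hs
    have hd : D ∣ T''.sum := Multiset.dvd_sum fun z hz => by
      obtain ⟨z', hz', ha⟩ := Multiset.exists_mem_of_rel_of_mem (Multiset.rel_flip.2 hT'') hz
      exact (dvd_iff_of_associated ha).1 (hS z' (Multiset.mem_of_le hT₁ hz'))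
    exact hx ((dvd_iff_of_associated hy).2 ((dvd_add_left hd).1 (hs ▸ dvd_zero D)))
  · exact (Multiset.le_cons_of_notMem hxT).1 hle

theorem IsUnitZeroSum.le_of_le_ofFn_add {R : Type*} [CommRing R] {k : ℕ} :
    ∀ {x D : Fin k → R} {S T : Multiset R}, IsUnitZeroSum T → T ≤ (List.ofFn x : Multiset R) + S →
      (∀ i, ¬ D i ∣ x i) → (∀ i j, i < j → D i ∣ x j) → (∀ i, ∀ y ∈ S, D i ∣ y) → T ≤ S := by
  induction k with
  | zero => intro x D S T _ h _ _ _; simpa using h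
  | succ k ih =>
    intro x D S T hT hle h1 h2 h3
    rw [List.ofFn_succ, ← Multiset.cons_coe, Multiset.cons_add] at hle
    refine ih (x := fun i => x i.succ) (D := fun i => D i.succ) hT
      (hT.le_of_le_cons hle (h1 0) fun y hy => ?_) (fun i => h1 _)
      (fun i j hij => h2 _ _ (Fin.succ_lt_succ_iff.2 hij)) (fun i => h3 _)
    rcases Multiset.mem_add.1 hy with hy | hy
    · obtain ⟨j, rfl⟩ := (List.mem_ofFn' _ _).1 (Multiset.mem_coe.1 hy)
      exact h2 _ _ (Fin.succ_pos j)
    · exact h3 0 y hy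

theorem natCast_dvd_intCast_iff {n d : ℕ} (hd : d ∣ n) (a : ℤ) :
    (d : ZMod n) ∣ (a : ZMod n) ↔ (d : ℤ) ∣ a := by
  constructor
  · rintro ⟨y, hy⟩
    obtain ⟨y, rfl⟩ := ZMod.intCast_surjective y
    have h : ((d * y - a : ℤ) : ZMod n) = 0 := by push_cast; rw [hy, sub_self]
    rw [ZMod.intCast_zmod_eq_zero_iff_dvd] at h
    exact (dvd_sub_right (dvd_mul_right _ _)).1 ((Int.natCast_dvd_natCast.2 hd).trans h)
  · rintro ⟨y, rfl⟩
    exact ⟨(y : ZMod n), by push_cast; rfl⟩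

open Classical in
theorem even_countP_of_isUnitZeroSum {n R : ℕ} (hR : 2 ^ (R + 1) ∣ n) {T : Multiset (ZMod n)}
    (hT : ∀ x ∈ T, ((2 ^ R : ℕ) : ZMod n) ∣ x) (hz : IsUnitZeroSum T) :
    Even (T.countP fun x => ¬ ((2 ^ (R + 1) : ℕ) : ZMod n) ∣ x) := by
  have key : ∀ (T T' : Multiset (ZMod n)), Multiset.Rel Associated T T' →
      (∀ x ∈ T, ((2 ^ R : ℕ) : ZMod n) ∣ x) →
      ((2 ^ (R + 1) : ℕ) : ZMod n) ∣ T'.sum -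
        ((2 ^ R * (T.countP fun x => ¬ ((2 ^ (R + 1) : ℕ) : ZMod n) ∣ x) : ℤ) : ZMod n) := by
    intro T T' h
    induction h with
    | zero => intro _; simp
    | @cons a b as bs hab _ ih =>
      intro hd
      have ih := ih fun x hx => hd x (Multiset.mem_cons_of_mem hx)
      rw [Multiset.sum_cons, Multiset.countP_cons]
      by_cases ha : ((2 ^ (R + 1) : ℕ) : ZMod n) ∣ a
      · rw [if_neg (not_not.2 ha), add_zero, add_sub_assoc]
        exact dvd_add ((dvd_iff_of_associated hab).1 ha) ih
      · rw [if_pos ha]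
        have hb : ((2 ^ (R + 1) : ℕ) : ZMod n) ∣ b - ((2 ^ R : ℕ) : ZMod n) := by
          obtain ⟨y, rfl⟩ := (dvd_iff_of_associated hab).1 (hd a (Multiset.mem_cons_self _ _))
          obtain ⟨y, rfl⟩ := ZMod.intCast_surjective y
          rw [dvd_iff_of_associated hab] at ha
          rcases Int.even_or_odd' y with ⟨z, rfl | rfl⟩
          · exact absurd ⟨(z : ZMod n), by push_cast; ring⟩ ha
          · exact ⟨(z : ZMod n), by push_cast; ring⟩
        convert dvd_add hb ih using 1
        push_cast
        ring
  obtain ⟨T', h, hs⟩ := hz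
  have h := key T T' h hT
  rw [hs, zero_sub, dvd_neg, natCast_dvd_intCast_iff hR] at h
  have h : 2 ^ R * 2 ∣ 2 ^ R * T.countP fun x => ¬ ((2 ^ (R + 1) : ℕ) : ZMod n) ∣ x := by
    rw [← pow_succ]; exact_mod_cast h
  exact even_iff_two_dvd.2 (Nat.dvd_of_mul_dvd_mul_left (by positivity) h)

/-! ### The listed sequences have no weighted zero-sum subsequence of length `n` -/

section Chains

variable {n k : ℕ} {q : Fin k → ℕ} {b : Fin k → ℤ}

theorem prod_Iic_eq (q : Fin k → ℕ) (i : Fin k) :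
    ∏ j ∈ Finset.Iic i, q j = (∏ j ∈ Finset.Iio i, q j) * q i := by
  rw [← Finset.Iio_insert, Finset.prod_insert (by simp), mul_comm]

theorem not_dvd_chain (hq : ∀ i, (q i).Prime) (hn : ∏ i, q i ∣ n)
    (hb : ∀ i, IsCoprime (b i) (q i : ℤ)) (i : Fin k) :
    ¬ ((∏ j ∈ Finset.Iic i, q j : ℕ) : ZMod n) ∣
      (((∏ j ∈ Finset.Iio i, (q j : ℤ)) * b i : ℤ) : ZMod n) := by
  have hd : ∏ j ∈ Finset.Iic i, q j ∣ n :=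
    (Finset.prod_dvd_prod_of_subset _ _ _ (Finset.subset_univ _)).trans hn
  rw [natCast_dvd_intCast_iff hd, prod_Iic_eq]
  push_cast
  intro h
  have h0 : (∏ j ∈ Finset.Iio i, (q j : ℤ)) ≠ 0 :=
    Finset.prod_ne_zero_iff.2 fun j _ => by exact_mod_cast (hq j).ne_zero
  have h1 := (mul_dvd_mul_iff_left h0).1 h
  have h2 : IsUnit (q i : ℤ) := (hb i).isUnit_of_dvd' h1 dvd_rfl
  exact (Nat.prime_iff_prime_int.1 (hq i)).not_isUnit h2

theorem dvd_chain {i j : Fin k} (hij : i < j) :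
    ((∏ l ∈ Finset.Iic i, q l : ℕ) : ZMod n) ∣
      (((∏ l ∈ Finset.Iio j, (q l : ℤ)) * b j : ℤ) : ZMod n) := by
  have h : Finset.Iic i ⊆ Finset.Iio j := fun l hl =>
    Finset.mem_Iio.2 ((Finset.mem_Iic.1 hl).trans_lt hij)
  have h' : ((∏ l ∈ Finset.Iic i, q l : ℕ) : ℤ) ∣ (∏ l ∈ Finset.Iio j, (q l : ℤ)) * b j := by
    push_cast
    exact (Finset.prod_dvd_prod_of_subset _ _ _ h).mul_right _
  simpa using map_dvd (Int.castRingHom (ZMod n)) h'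

theorem not_hasUnitZeroSum_star (hn0 : 0 < n) (hq : ∀ i, (q i).Prime) (hn : n = ∏ i, q i)
    (hb : ∀ i, IsCoprime (b i) (q i : ℤ)) :
    ¬ HasUnitZeroSum (((List.ofFn fun i : Fin k =>
      (((∏ j ∈ Finset.Iio i, (q j : ℤ)) * b i : ℤ) : ZMod n)) ++
        List.replicate (n - 1) (0 : ZMod n) : List (ZMod n)) : Multiset (ZMod n)) n := by
  rintro ⟨T, hT, hc, hz⟩
  rw [← Multiset.coe_add] at hT
  have h := hz.le_of_le_ofFn_add hT (not_dvd_chain hq hn.symm.dvd hb)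
    (fun i j hij => dvd_chain hij) fun i y hy => by
      rw [List.eq_of_mem_replicate (Multiset.mem_coe.1 hy)]
      exact dvd_zero _
  have := Multiset.card_le_card h
  simp only [Multiset.coe_card, List.length_replicate] at this
  omega

theorem not_hasUnitZeroSum_ast {R m p : ℕ} (hR : n = 2 ^ (R + 1) * p)
    (hodd : Odd p) (hq : ∀ i, (q i).Prime)
    (hn : n = 2 * ∏ i, q i) (hb : ∀ i, IsCoprime (b i) (q i : ℤ)) (hm : Odd m) (hmn : m ≤ n) :
    ¬ HasUnitZeroSum (((List.ofFn fun i : Fin k =>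
      (((∏ j ∈ Finset.Iio i, (q j : ℤ)) * b i : ℤ) : ZMod n)) ++
        (List.replicate m ((n / 2 : ℕ) : ZMod n) ++ List.replicate (n - m) (0 : ZMod n)) :
        List (ZMod n)) : Multiset (ZMod n)) n := by
  classical
  rintro ⟨T, hT, hc, hz⟩
  have hhalf : n / 2 = ∏ i, q i := by omega
  rw [← Multiset.coe_add] at hT
  have h := hz.le_of_le_ofFn_add hT
    (not_dvd_chain hq (by rw [hn]; exact dvd_mul_left _ _) hb)
    (fun i j hij => dvd_chain hij) fun i y hy => by
      rcases List.mem_append.1 (Multiset.mem_coe.1 hy) with hy | hy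
      · rw [List.eq_of_mem_replicate hy, hhalf]
        exact Nat.cast_dvd_cast (Finset.prod_dvd_prod_of_subset _ _ _ (Finset.subset_univ _))
      · rw [List.eq_of_mem_replicate hy]
        exact dvd_zero _
  have e := Multiset.eq_of_le_of_card_le h (by
    simp only [Multiset.coe_card, List.length_append, List.length_replicate]; omega)
  have hhalf' : n / 2 = 2 ^ R * p := by
    rw [hR, pow_succ, mul_right_comm, Nat.mul_div_cancel _ two_pos]
  have hnd : ¬ ((2 ^ (R + 1) : ℕ) : ZMod n) ∣ ((n / 2 : ℕ) : ZMod n) := by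
    rw [← Int.cast_natCast (n / 2), natCast_dvd_intCast_iff (Dvd.intro _ hR.symm),
      Int.natCast_dvd_natCast, hhalf', pow_succ, Nat.mul_dvd_mul_iff_left (by positivity)]
    exact fun h => Nat.not_even_iff_odd.2 hodd (even_iff_two_dvd.2 h)
  have hev := even_countP_of_isUnitZeroSum (Dvd.intro _ hR.symm) (T := T) (fun x hx => by
    rw [e] at hx
    rcases List.mem_append.1 (Multiset.mem_coe.1 hx) with hx | hx
    · rw [List.eq_of_mem_replicate hx, hhalf']
      exact Nat.cast_dvd_cast (dvd_mul_right _ _)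
    · rw [List.eq_of_mem_replicate hx]
      exact dvd_zero _) hz
  rw [e, ← Multiset.coe_add, Multiset.countP_add, Multiset.coe_replicate, Multiset.coe_replicate,
    Multiset.countP_eq_card.2 fun x hx => by rwa [Multiset.eq_of_mem_replicate hx],
    Multiset.countP_eq_zero.2 fun x hx => by
      rw [Multiset.eq_of_mem_replicate hx]; exact not_not.2 (dvd_zero _)] at hev
  rw [Multiset.card_replicate, add_zero] at hev
  exact Nat.not_even_iff_odd.2 hm hev

end Chains

theorem not_hasUnitZeroSum_doubleAst {n R p : ℕ} (hp : p.Prime) (hpodd : p ≠ 2)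
    (hn : n = 2 ^ (R + 1) * p) (a : Fin R → ℤ) (ha : ∀ i, Odd (a i)) {c : ℤ}
    (hc : (2 ^ (R + 1) : ℤ) ∣ c) :
    ¬ HasUnitZeroSum (((List.ofFn fun i : Fin R => ((2 ^ (i : ℕ) * a i : ℤ) : ZMod n)) ++
      [((c : ℤ) : ZMod n)] ++ [((2 ^ R : ℤ) : ZMod n)] ++
        List.replicate (n - 1) ((n / 2 : ℕ) : ZMod n) : List (ZMod n)) : Multiset (ZMod n)) n := by
  classical
  rintro ⟨T, hT, hcard, hz⟩
  have hpo : Odd p := hp.odd_of_ne_two hpodd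
  have hhalf : n / 2 = 2 ^ R * p := by
    rw [hn, pow_succ, mul_right_comm, Nat.mul_div_cancel _ two_pos]
  have hdvd : ∀ i, i ≤ R + 1 → 2 ^ i ∣ n := fun i hi => by
    rw [hn]; exact (pow_dvd_pow 2 hi).mul_right p
  have hcast : ∀ i, i ≤ R + 1 → ∀ x : ℤ,
      (((2 ^ i : ℕ) : ZMod n) ∣ ((x : ℤ) : ZMod n) ↔ (2 ^ i : ℤ) ∣ x) := fun i hi x => by
    rw [natCast_dvd_intCast_iff (hdvd i hi)]; push_cast; rfl
  have hhd : ∀ i, i ≤ R → ((2 ^ i : ℕ) : ZMod n) ∣ ((n / 2 : ℕ) : ZMod n) := fun i hi => by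
    rw [hhalf]; exact Nat.cast_dvd_cast ((pow_dvd_pow 2 hi).mul_right p)
  have htop : ∀ x : ℤ, Odd x → ∀ i, ¬ (2 ^ (i + 1) : ℤ) ∣ 2 ^ i * x := fun x hx i h => by
    rw [pow_succ] at h
    have := (mul_dvd_mul_iff_left (by positivity)).1 h
    exact Int.not_even_iff_odd.2 hx (even_iff_two_dvd.2 this)
  rw [← Multiset.coe_add, ← Multiset.coe_add, ← Multiset.coe_add, add_assoc, add_assoc,
    Multiset.coe_singleton, Multiset.coe_singleton, Multiset.singleton_add,
    Multiset.singleton_add, Multiset.coe_replicate] at hT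
  have hle := hz.le_of_le_ofFn_add (D := fun i : Fin R => ((2 ^ ((i : ℕ) + 1) : ℕ) : ZMod n)) hT
    (fun i => by
      rw [hcast _ (by omega)]
      exact htop _ (ha i) _)
    (fun i j hij => by
      rw [hcast _ (by omega)]
      exact (pow_dvd_pow 2 (by omega)).mul_right _)
    (fun i y hy => by
      rw [Multiset.mem_cons, Multiset.mem_cons] at hy
      rcases hy with rfl | rfl | hy
      · rw [hcast _ (by omega)]
        exact (pow_dvd_pow 2 (by omega)).trans hc
      · rw [hcast _ (by omega)]
        exact pow_dvd_pow 2 (by omega)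
      · rw [Multiset.eq_of_mem_replicate hy]
        exact hhd _ (by omega))
  have hn1 : 1 ≤ n := by
    rw [hn]; exact Nat.mul_pos (by positivity) hp.pos
  have hneven : Even n := by
    rw [even_iff_two_dvd]; simpa using hdvd 1 (by omega)
  have hR0 : ¬ ((2 ^ (R + 1) : ℕ) : ZMod n) ∣ ((2 ^ R : ℤ) : ZMod n) := by
    rw [hcast _ le_rfl]
    simpa using htop 1 odd_one R
  have hR1 : ¬ ((2 ^ (R + 1) : ℕ) : ZMod n) ∣ ((n / 2 : ℕ) : ZMod n) := by
    rw [← Int.cast_natCast (n / 2), hcast _ le_rfl, hhalf]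
    push_cast
    exact htop p (by exact_mod_cast hpo) R
  have hle2 : T ≤ ((2 ^ R : ℤ) : ZMod n) ::ₘ
      Multiset.replicate (n - 1) ((n / 2 : ℕ) : ZMod n) := by
    by_cases hcT : (c : ZMod n) ∈ T
    · exfalso
      obtain ⟨T₁, rfl⟩ := Multiset.exists_cons_of_mem hcT
      have hT₁ := (Multiset.cons_le_cons_iff _).1 hle
      have hev := even_countP_of_isUnitZeroSum (hdvd _ le_rfl) (fun x hx => by
        have hx := Multiset.mem_of_le hle hx
        rw [Multiset.mem_cons, Multiset.mem_cons] at hx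
        rcases hx with rfl | rfl | hx
        · rw [hcast _ (by omega)]
          exact (pow_dvd_pow 2 (by omega)).trans hc
        · rw [hcast _ (by omega)]
        · rw [Multiset.eq_of_mem_replicate hx]
          exact hhd _ le_rfl) hz
      rw [Multiset.countP_cons, if_neg (not_not.2 ((hcast _ le_rfl c).2 hc)), add_zero,
        Multiset.countP_eq_card.2 fun x hx => by
          have hx := Multiset.mem_of_le hT₁ hx
          rw [Multiset.mem_cons] at hx
          rcases hx with rfl | hx
          · exact hR0
          · rwa [Multiset.eq_of_mem_replicate hx]] at hev
      rw [Multiset.card_cons] at hcard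
      rw [← hcard, Nat.even_add_one] at hneven
      exact hneven hev
    · exact (Multiset.le_cons_of_notMem hcT).1 hle
  have hpn : p ∣ n := by rw [hn]; exact dvd_mul_left _ _
  have hle3 := hz.le_of_le_cons (D := ((p : ℕ) : ZMod n)) hle2
    (by
      rw [natCast_dvd_intCast_iff hpn]
      intro h
      have h2 : p ∣ 2 := hp.dvd_of_dvd_pow (by exact_mod_cast h : p ∣ 2 ^ R)
      exact hpodd ((Nat.prime_dvd_prime_iff_eq hp Nat.prime_two).1 h2))
    (fun y hy => by
      rw [Multiset.eq_of_mem_replicate hy, hhalf]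
      exact Nat.cast_dvd_cast (dvd_mul_left _ _))
  have := Multiset.card_le_card hle3
  rw [Multiset.card_replicate] at this
  omega

/-! ### Balanced types yield zero-sums -/

/-- The standard representative `2 ^ e` or `2 ^ e * p` of a type. -/
def typeRep (p : ℕ) (x : ℕ × Bool) : ℕ := 2 ^ x.1 * if x.2 then 1 else p

theorem exists_associated_typeRep {r p : ℕ} (hp : p.Prime) (a : ZMod (2 ^ r * p)) :
    ∃ x : ℕ × Bool, x.1 ≤ r ∧ Associated a (typeRep p x : ZMod (2 ^ r * p)) := by
  obtain ⟨d, hd, u, hu, rfl⟩ := a.eq_unit_mul_divisor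
  obtain ⟨d₁, d₂, h1, h2, rfl⟩ := (Nat.dvd_mul).1 hd
  obtain ⟨e, he, rfl⟩ := (Nat.dvd_prime_pow Nat.prime_two).1 h1
  obtain ⟨u, rfl⟩ := hu
  rcases (Nat.dvd_prime hp).1 h2 with rfl | rfl
  · exact ⟨(e, true), he, Associated.symm ⟨u, by simp [typeRep, mul_comm]⟩⟩
  · exact ⟨(e, false), he, Associated.symm ⟨u, by simp [typeRep, mul_comm]⟩⟩

theorem exists_rel_typeRep {r p : ℕ} (hp : p.Prime) (S : Multiset (ZMod (2 ^ r * p))) :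
    ∃ M : Multiset (ℕ × Bool), (∀ x ∈ M, x.1 ≤ r) ∧
      Multiset.Rel Associated S (M.map fun x => (typeRep p x : ZMod (2 ^ r * p))) := by
  induction S using Multiset.induction_on with
  | empty => exact ⟨0, by simp⟩
  | cons a S ih =>
    obtain ⟨M, hM, h⟩ := ih
    obtain ⟨x, hx, hax⟩ := exists_associated_typeRep hp a
    refine ⟨x ::ₘ M, ?_, by rw [Multiset.map_cons]; exact Multiset.Rel.cons hax h⟩
    intro y hy
    rcases Multiset.mem_cons.1 hy with rfl | hy
    exacts [hx, hM y hy]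

theorem exists_unit_weights_prime {ι : Type*} [Fintype ι] [DecidableEq ι] {p : ℕ} [Fact p.Prime]
    (hp : p ≠ 2) (x : ι → ZMod p) (h : (Finset.univ.filter fun i => x i ≠ 0).card ≠ 1) :
    ∃ w : ι → ZMod p, (∀ i, IsUnit (w i)) ∧ ∑ i, w i * x i = 0 := by
  rcases (by omega : (Finset.univ.filter fun i => x i ≠ 0).card = 0 ∨
    1 < (Finset.univ.filter fun i => x i ≠ 0).card) with h | h
  · refine ⟨1, fun i => isUnit_one, Finset.sum_eq_zero fun i _ => ?_⟩
    have := Finset.filter_eq_empty_iff.1 (Finset.card_eq_zero.1 h) (Finset.mem_univ i)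
    simpa using this
  · obtain ⟨i, hi, j, hj, hij⟩ := Finset.one_lt_card.1 h
    have hi : x i ≠ 0 := by simpa using hi
    have hj : x j ≠ 0 := by simpa using hj
    obtain ⟨s, hs⟩ : ∃ s, s = ∑ l ∈ (Finset.univ.erase i).erase j, x l := ⟨_, rfl⟩
    obtain ⟨α, hα0, hαs⟩ : ∃ α : ZMod p, α ≠ 0 ∧ α ≠ -s := by
      have hcard : ({0, -s} : Finset (ZMod p)).card < (Finset.univ : Finset (ZMod p)).card := by
        rw [Finset.card_univ, ZMod.card]
        have := (Fact.out : p.Prime).two_le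
        exact lt_of_le_of_lt Finset.card_le_two (by omega)
      obtain ⟨α, -, hα⟩ := Finset.exists_mem_notMem_of_card_lt_card hcard
      exact ⟨α, by simpa using hα⟩
    refine ⟨fun l => if l = i then α / x i else if l = j then (-s - α) / x j else 1,
      fun l => ?_, ?_⟩
    · rw [isUnit_iff_ne_zero]
      dsimp only
      split_ifs
      · exact div_ne_zero hα0 hi
      · exact div_ne_zero (fun h => hαs (sub_eq_zero.1 h).symm) hj
      · exact one_ne_zero
    · rw [← Finset.add_sum_erase _ _ (Finset.mem_univ i),
        ← Finset.add_sum_erase _ _ (Finset.mem_erase.2 ⟨hij.symm, Finset.mem_univ j⟩)]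
      rw [Finset.sum_congr rfl (g := x) fun l hl => by
        simp only [Finset.mem_erase] at hl
        simp [hl.1, hl.2.1], ← hs]
      simp only [if_true, hij.symm, if_false]
      field_simp
      ring

theorem isUnit_one_add_two_mul {r : ℕ} (y : ZMod (2 ^ r)) : IsUnit (1 + 2 * y) := by
  have : IsNilpotent (2 * y) := ⟨r, by
    have h : (2 : ZMod (2 ^ r)) ^ r = 0 := by
      exact_mod_cast ZMod.natCast_self (2 ^ r)
    rw [mul_pow, h, zero_mul]⟩
  exact this.isUnit_one_add

theorem sum_two_pow_mul_odd {ι : Type*} {R : Type*} [CommRing R] (s : Finset ι) (e : ℕ)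
    (f c : ι → ℕ) (hf : ∀ i ∈ s, e ≤ f i) (hc : ∀ i ∈ s, Odd (c i)) :
    (2 : R) ^ (e + 1) ∣ ∑ i ∈ s, (2 ^ f i * c i : R) - 2 ^ e * ((s.filter (f · = e)).card : R) := by
  classical
  induction s using Finset.induction_on with
  | empty => simp
  | insert a s ha ih =>
    have ih := ih (fun i hi => hf i (Finset.mem_insert_of_mem hi))
      (fun i hi => hc i (Finset.mem_insert_of_mem hi))
    have hle := hf a (Finset.mem_insert_self _ _)
    obtain ⟨z, hz⟩ := hc a (Finset.mem_insert_self _ _)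
    rw [Finset.sum_insert ha, Finset.filter_insert]
    split_ifs with h
    · rw [Finset.card_insert_of_notMem (by simp [ha])]
      have h1 : (2 : R) ^ (e + 1) ∣ 2 ^ f a * c a - 2 ^ e :=
        ⟨(z : R), by rw [h, hz]; push_cast; ring⟩
      convert dvd_add h1 ih using 1
      push_cast
      ring
    · rw [add_sub_assoc]
      exact dvd_add ((pow_dvd_pow _ (by omega)).mul_right _) ih

theorem exists_unit_weights_two {ι : Type*} [Fintype ι] [DecidableEq ι] {r : ℕ} (f c : ι → ℕ)
    (hc : ∀ i, Odd (c i))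
    (h : (∀ i, f i = r) ∨ ∃ e, (∀ i, e ≤ f i) ∧ 0 < (Finset.univ.filter (f · = e)).card ∧
      (Finset.univ.filter (f · = e)).card % 2 = 0) :
    ∃ w : ι → ZMod (2 ^ r), (∀ i, IsUnit (w i)) ∧
      ∑ i, w i * (2 ^ f i * c i : ZMod (2 ^ r)) = 0 := by
  rcases h with h | ⟨e, he, hpos, heven⟩
  · refine ⟨1, fun i => isUnit_one, Finset.sum_eq_zero fun i _ => ?_⟩
    have h0 : (2 : ZMod (2 ^ r)) ^ r = 0 := by
      exact_mod_cast ZMod.natCast_self (2 ^ r)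
    rw [h, h0, zero_mul, mul_zero]
  · obtain ⟨i, hi⟩ := Finset.card_pos.1 hpos
    have hi : f i = e := by simpa using hi
    have hd := sum_two_pow_mul_odd (R := ZMod (2 ^ r)) Finset.univ e f c (fun i _ => he i)
      (fun i _ => hc i)
    have hd2 : (2 : ZMod (2 ^ r)) ^ (e + 1) ∣
        2 ^ e * ((Finset.univ.filter (f · = e)).card : ZMod (2 ^ r)) := by
      obtain ⟨m, hm⟩ := Nat.dvd_of_mod_eq_zero heven
      exact ⟨(m : ZMod (2 ^ r)), by rw [hm]; push_cast; ring⟩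
    obtain ⟨y, hy⟩ : (2 : ZMod (2 ^ r)) ^ (e + 1) ∣ ∑ i, (2 ^ f i * c i : ZMod (2 ^ r)) := by
      simpa using dvd_add hd hd2
    obtain ⟨u, hu⟩ : IsUnit (c i : ZMod (2 ^ r)) := by
      obtain ⟨z, hz⟩ := hc i
      rw [hz, add_comm]
      simpa using isUnit_one_add_two_mul (r := r) (z : ZMod (2 ^ r))
    refine ⟨fun l => 1 + 2 * (if l = i then -(y * (u⁻¹ : (ZMod (2 ^ r))ˣ)) else 0),
      fun l => isUnit_one_add_two_mul _, ?_⟩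
    simp only [add_mul, one_mul, Finset.sum_add_distrib, hy]
    rw [Finset.sum_eq_single i (fun l _ hl => by simp [hl]) (by simp), if_pos rfl, hi, ← hu]
    linear_combination (-2 ^ (e + 1) * y) * u.inv_mul

theorem isUnitZeroSum_map_of_weights {ι R : Type*} [Fintype ι] [CommRing R] (x w : ι → R)
    (hw : ∀ i, IsUnit (w i)) (h : ∑ i, w i * x i = 0) :
    IsUnitZeroSum (Finset.univ.val.map x) := by
  refine ⟨Finset.univ.val.map fun i => w i * x i, ?_, h⟩
  rw [Multiset.rel_map]
  refine Multiset.rel_refl_of_refl_on fun i _ => ?_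
  obtain ⟨u, hu⟩ := hw i
  exact ⟨u, by rw [hu, mul_comm]⟩

theorem isUnitZeroSum_of_unitBalanced {r p : ℕ} (hp : p.Prime) (hpodd : p ≠ 2)
    {T : Multiset (ℕ × Bool)} (hT : UnitBalanced r T) :
    IsUnitZeroSum (T.map fun x => (typeRep p x : ZMod (2 ^ r * p))) := by
  have : Fact p.Prime := ⟨hp⟩
  obtain ⟨N, y, rfl⟩ : ∃ (N : ℕ) (y : Fin N → ℕ × Bool), T = Finset.univ.val.map y := by
    induction T using Quotient.inductionOn with
    | _ l => exact ⟨l.length, l.get, by rw [Fin.univ_val_map, List.ofFn_get]; rfl⟩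
  obtain ⟨h2, hpz⟩ := hT
  obtain ⟨w₂, hw₂, hs₂⟩ := exists_unit_weights_two (r := r) (fun i => (y i).1)
    (fun i => if (y i).2 then 1 else p)
    (fun i => by split_ifs; exacts [odd_one, hp.odd_of_ne_two hpodd]) (by
      rcases h2 with h | ⟨e, -, h1, h2, h3⟩
      · exact Or.inl fun i => h _ (Multiset.mem_map_of_mem y (Finset.mem_univ i))
      · rw [Multiset.countP_map] at h2 h3
        exact Or.inr ⟨e, fun i => h1 _ (Multiset.mem_map_of_mem y (Finset.mem_univ i)), h2, h3⟩)
  have h20 : (2 : ZMod p) ≠ 0 := fun h => by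
    have : ((2 : ℕ) : ZMod p) = 0 := by exact_mod_cast h
    rw [ZMod.natCast_eq_zero_iff] at this
    exact hpodd ((Nat.prime_dvd_prime_iff_eq hp Nat.prime_two).1 this)
  have hne : ∀ i, (typeRep p (y i) : ZMod p) ≠ 0 ↔ (y i).2 = true := fun i => by
    rcases hy : (y i).2 <;> simp [typeRep, hy, h20]
  obtain ⟨wₚ, hwₚ, hsₚ⟩ := exists_unit_weights_prime hpodd
    (fun i => (typeRep p (y i) : ZMod p)) (by
      rw [Multiset.countP_map] at hpz
      simp only [hne]
      exact hpz)
  have hcop : Nat.Coprime (2 ^ r) p :=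
    Nat.Coprime.pow_left r ((Nat.coprime_primes Nat.prime_two hp).2 hpodd.symm)
  let φ := ZMod.chineseRemainder hcop
  rw [Multiset.map_map]
  refine isUnitZeroSum_map_of_weights _ (fun i => φ.symm (w₂ i, wₚ i))
    (fun i => (Prod.isUnit_iff.2 ⟨hw₂ i, hwₚ i⟩).map φ.symm) ?_
  apply φ.injective
  rw [map_sum, map_zero]
  simp only [map_mul, RingEquiv.apply_symm_apply, Function.comp, map_natCast]
  refine Prod.ext ?_ ?_
  · rw [Prod.fst_sum]
    simp only [Prod.fst_mul, Prod.fst_natCast]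
    simpa [typeRep] using hs₂
  · rw [Prod.snd_sum]
    simpa using hsₚ

theorem HasBalanced.hasUnitZeroSum {n r p : ℕ} (hp : p.Prime) (hpodd : p ≠ 2)
    {M : Multiset (ℕ × Bool)} (h : HasBalanced n r M) :
    HasUnitZeroSum (M.map fun x => (typeRep p x : ZMod (2 ^ r * p))) n := by
  obtain ⟨T, hT, hc, hb⟩ := h
  exact ⟨_, Multiset.map_le_map hT, by rw [Multiset.card_map, hc],
    isUnitZeroSum_of_unitBalanced hp hpodd hb⟩

/-! ### Chains of the listed forms -/

/-- The factorization of `2 ^ (k - 1) * p` into `k` primes with `p` in position `t`. -/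
def primeAt (p t i : ℕ) : ℕ := if i = t then p else 2

theorem primeAt_prime {p : ℕ} (hp : p.Prime) (t i : ℕ) : (primeAt p t i).Prime := by
  unfold primeAt
  split_ifs
  exacts [hp, Nat.prime_two]

theorem prod_range_primeAt (p t k : ℕ) :
    ∏ i ∈ Finset.range k, primeAt p t i = if k ≤ t then 2 ^ k else 2 ^ (k - 1) * p := by
  induction k with
  | zero => simp
  | succ k ih =>
    rw [Finset.prod_range_succ, ih, primeAt]
    rcases lt_trichotomy k t with h | rfl | h
    · rw [if_pos h.le, if_neg h.ne, if_pos (Nat.succ_le_of_lt h), pow_succ]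
    · simp
    · obtain ⟨k, rfl⟩ : ∃ l, k = l + 1 := ⟨k - 1, by omega⟩
      rw [if_neg (by omega), if_neg (by omega), if_neg (by omega), Nat.add_sub_cancel,
        Nat.add_sub_cancel]
      ring

theorem coe_ofFn_val {α : Type*} (k : ℕ) (f : ℕ → α) :
    ((List.ofFn fun i : Fin k => f i : List α) : Multiset α) = (Multiset.range k).map f := by
  rw [List.ofFn_eq_map, ← Multiset.map_coe, Multiset.range, ← List.map_coe_finRange_eq_range,
    ← Multiset.map_coe, Multiset.map_map]
  rfl

theorem coe_ofFn_chain {n : ℕ} (k : ℕ) (q b : ℕ → ℕ) :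
    ((List.ofFn fun i : Fin k => (((∏ j ∈ Finset.Iio i, (q j : ℤ)) * (b i : ℤ) : ℤ) : ZMod n) :
      List (ZMod n)) : Multiset (ZMod n)) =
      (Multiset.range k).map fun i => (((∏ j ∈ Finset.range i, q j) * b i : ℕ) : ZMod n) := by
  rw [← coe_ofFn_val]
  congr 2
  funext i
  have h : ∏ j ∈ Finset.Iio i, (q j : ℤ) = ∏ j ∈ Finset.range i, (q j : ℤ) := by
    rw [← Nat.Iio_eq_range, ← Fin.map_valEmbedding_Iio, Finset.prod_map]
    rfl
  rw [h]
  push_cast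
  rfl

theorem map_range_succ_insert {α : Type*} {F G : ℕ → α} {x : α} {t R : ℕ} (htR : t ≤ R)
    (hlt : ∀ i < t, F i = G i) (heq : F t = x) (hgt : ∀ i, t ≤ i → i < R → F (i + 1) = G i) :
    (Multiset.range (R + 1)).map F = (Multiset.range R).map G + {x} := by
  induction R, htR using Nat.le_induction with
  | base =>
    rw [Multiset.range_succ, Multiset.map_cons, heq, Multiset.add_comm, Multiset.singleton_add,
      Multiset.map_congr rfl fun i hi => hlt i (Multiset.mem_range.1 hi)]
  | succ R h ih =>
    rw [Multiset.range_succ, Multiset.map_cons, ih fun i h1 h2 => hgt i h1 (by omega),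
      Multiset.range_succ, Multiset.map_cons, Multiset.cons_add, hgt R h (by omega)]

theorem map_ladder_zero {α : Type*} (g : ℕ → Bool) (R : ℕ) (f : ℕ × Bool → α) :
    (ladder g 0 R).map f = (Multiset.range R).map fun i => f (i, g i) := by
  rw [ladder, Multiset.map_map, ← Finset.range_eq_Ico]
  rfl

theorem two_pow_succ_mul_div_two (R p : ℕ) : 2 ^ (R + 1) * p / 2 = 2 ^ R * p := by
  rw [pow_succ, mul_right_comm, Nat.mul_div_cancel _ two_pos]

theorem cast_typeRep_top (r p : ℕ) : (typeRep p (r, false) : ZMod (2 ^ r * p)) = 0 :=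
  ZMod.natCast_self _

/-! ### The value of the Gao constant -/

theorem hasUnitZeroSum_of_card {r p : ℕ} (hr : 1 ≤ r) (hp : p.Prime) (hpodd : p ≠ 2)
    {S : Multiset (ZMod (2 ^ r * p))} (hS : S.card = 2 ^ r * p + r + 1) :
    HasUnitZeroSum S (2 ^ r * p) := by
  obtain ⟨M, hM, hrel⟩ := exists_rel_typeRep hp S
  have hc := Multiset.card_eq_card_of_rel hrel
  rw [Multiset.card_map] at hc
  have h2 : 2 ≤ 2 ^ r := by simpa using Nat.pow_le_pow_right two_pos hr
  refine ((hasBalanced_of_card (j := 0) ?_ ?_ r (by omega) (fun x _ => Nat.zero_le _) hM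
    (by omega)).hasUnitZeroSum hp hpodd).of_rel hrel.associated_symm
  · exact Nat.mod_eq_zero_of_dvd ((dvd_pow_self 2 (by omega)).mul_right p)
  · exact Nat.mul_le_mul h2 hp.two_le

theorem gaoC_units_eq {r p : ℕ} (hr : 1 ≤ r) (hp : p.Prime) (hpodd : p ≠ 2) :
    GaoC (2 ^ r * p) (U (2 ^ r * p)) = 2 ^ r * p + r + 1 := by
  have hn0 : 0 < 2 ^ r * p := Nat.mul_pos (by positivity) hp.pos
  refine le_antisymm (Nat.sInf_le ⟨by omega, fun S hS => ?_⟩)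
    (le_csInf ⟨2 ^ r * p + r + 1, by omega, fun S hS => ?_⟩ fun k hk => ?_)
  iterate 2 exact (hasWZSS_iff hn0 S).2 (hasUnitZeroSum_of_card hr hp hpodd (by simpa using hS))
  by_contra! hlt
  have hbad := not_hasUnitZeroSum_star (n := 2 ^ r * p) (k := r + 1)
    (q := fun i => primeAt p r i) (b := fun _ => 1) hn0 (fun i => primeAt_prime hp r i)
    (by
      rw [Fin.prod_univ_eq_prod_range (primeAt p r), prod_range_primeAt, if_neg (by omega),
        Nat.add_sub_cancel])
    (fun i => isCoprime_one_left)
  rw [← hasWZSS_iff hn0] at hbad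
  obtain ⟨L, hL, hLbad⟩ : ∃ L : List (ZMod (2 ^ r * p)), L.length = 2 ^ r * p + r ∧
      ¬ HasWZSS (U (2 ^ r * p)) L (2 ^ r * p) := ⟨_, by
    rw [List.length_append, List.length_ofFn, List.length_replicate]
    omega, hbad⟩
  obtain ⟨h0, T, hT, hc⟩ := hk.2 (L.take k) (by
    rw [List.length_take]
    omega)
  exact hLbad ⟨h0, T, hT.trans (List.take_sublist _ _), hc⟩

/-! ### Extremal types as sequences of the listed forms -/

section Forms

variable {R p : ℕ}

/-- The odd part of the standard representative of a type is coprime to `2`. -/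
theorem coprime_two_ite (hp : p.Prime) (hpodd : p ≠ 2) (b : Bool) :
    Nat.Coprime (if b then 1 else p) 2 := by
  split_ifs
  exacts [Nat.coprime_one_left 2, (Nat.coprime_primes hp Nat.prime_two).2 hpodd]

/-- The cofactors in the chain with `p` in position `t` having the types `(i, g i)` for `i < t`,
`(v, true)` for `i = t` and `(i - 1, false)` afterwards. -/
def chainCofactor (p t v : ℕ) (g : ℕ → Bool) (i : ℕ) : ℕ :=
  if i < t then (if g i then 1 else p) else if i = t then 2 ^ (v - t) else 1

theorem isCoprime_chainCofactor (hp : p.Prime) (hpodd : p ≠ 2) (t v : ℕ) (g : ℕ → Bool) (i : ℕ) :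
    IsCoprime (chainCofactor p t v g i : ℤ) (primeAt p t i : ℤ) := by
  rw [Nat.isCoprime_iff_coprime, chainCofactor, primeAt]
  rcases lt_trichotomy i t with h | rfl | h
  · rw [if_pos h, if_neg h.ne]
    exact coprime_two_ite hp hpodd _
  · rw [if_neg (lt_irrefl _), if_pos rfl, if_pos rfl]
    exact Nat.Coprime.pow_left _ ((Nat.coprime_primes Nat.prime_two hp).2 hpodd.symm)
  · rw [if_neg (by omega), if_neg h.ne']
    exact Nat.coprime_one_left _

theorem map_range_chain {t v k n : ℕ} {g : ℕ → Bool} (htk : t ≤ k) (htv : t ≤ v)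
    (hg : ∀ i, t ≤ i → i < k → g i = false) :
    ((Multiset.range (k + 1)).map fun i =>
      (((∏ j ∈ Finset.range i, primeAt p t j) * chainCofactor p t v g i : ℕ) : ZMod n)) =
      ((ladder g 0 k + {(v, true)}).map fun x => (typeRep p x : ZMod n)) := by
  rw [Multiset.map_add, map_ladder_zero, Multiset.map_singleton]
  refine map_range_succ_insert htk (fun i hi => ?_) ?_ fun i hi hik => ?_
  · rw [prod_range_primeAt, chainCofactor, if_pos hi.le, if_pos hi, typeRep]
  · rw [prod_range_primeAt, chainCofactor, if_pos le_rfl, if_neg (lt_irrefl _), if_pos rfl,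
      ← pow_add, Nat.add_sub_cancel' htv, typeRep, if_pos rfl, mul_one]
  · rw [prod_range_primeAt, chainCofactor, if_neg (by omega), if_neg (by omega),
      if_neg (by omega), Nat.add_sub_cancel, mul_one, typeRep, hg i hi hik, if_neg (by simp)]

theorem coe_ast_eq {t v m : ℕ} {g : ℕ → Bool} (htR : t ≤ R) (htv : t ≤ v)
    (hg : ∀ i, t ≤ i → g i = false) :
    ((((List.ofFn fun i : Fin (R + 1) => (((∏ j ∈ Finset.Iio i, (primeAt p t j : ℤ)) *
        (chainCofactor p t v g i : ℤ) : ℤ) : ZMod (2 ^ (R + 1) * p))) ++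
      (List.replicate m ((2 ^ (R + 1) * p / 2 : ℕ) : ZMod (2 ^ (R + 1) * p)) ++
        List.replicate (2 ^ (R + 1) * p - m) (0 : ZMod (2 ^ (R + 1) * p)))) :
        List (ZMod (2 ^ (R + 1) * p))) : Multiset (ZMod (2 ^ (R + 1) * p))) =
      (ladder g 0 R + ((v, true) ::ₘ (Multiset.replicate m (R, false) +
        Multiset.replicate (2 ^ (R + 1) * p - m) (R + 1, false)))).map
          fun x => (typeRep p x : ZMod (2 ^ (R + 1) * p)) := by
  rw [← Multiset.coe_add, ← Multiset.coe_add, coe_ofFn_chain,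
    map_range_chain htR htv fun i hi _ => hg i hi, ← Multiset.singleton_add, ← add_assoc (ladder g 0 R),
    Multiset.map_add _ (_ + _) (_ + _), Multiset.map_add _ (Multiset.replicate _ _),
    Multiset.map_replicate, Multiset.map_replicate, cast_typeRep_top, two_pow_succ_mul_div_two,
    Multiset.coe_replicate, Multiset.coe_replicate]
  rfl

theorem coe_star_eq (g : ℕ → Bool) :
    ((((List.ofFn fun i : Fin (R + 2) => (((∏ j ∈ Finset.Iio i, (primeAt p (R + 1) j : ℤ)) *
        (chainCofactor p (R + 1) (R + 1) (Function.update g R true) i : ℤ) : ℤ) :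
          ZMod (2 ^ (R + 1) * p))) ++
      List.replicate (2 ^ (R + 1) * p - 1) (0 : ZMod (2 ^ (R + 1) * p))) :
        List (ZMod (2 ^ (R + 1) * p))) : Multiset (ZMod (2 ^ (R + 1) * p))) =
      (ladder g 0 R + ((R, true) ::ₘ (R + 1, true) ::ₘ
        Multiset.replicate (2 ^ (R + 1) * p - 1) (R + 1, false))).map
          fun x => (typeRep p x : ZMod (2 ^ (R + 1) * p)) := by
  have hladder : ladder (Function.update g R true) 0 (R + 1) = ladder g 0 R + {(R, true)} := by
    rw [← Multiset.map_id (ladder _ 0 (R + 1)), ← Multiset.map_id (ladder g 0 R),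
      map_ladder_zero, map_ladder_zero, Multiset.range_succ, Multiset.map_cons,
      Function.update_self, add_comm, Multiset.singleton_add]
    congr 1
    exact Multiset.map_congr rfl fun i hi => by
      rw [Function.update_of_ne (Multiset.mem_range.1 hi).ne]
  rw [← Multiset.coe_add, coe_ofFn_chain,
    map_range_chain le_rfl le_rfl fun i hi hi' => absurd hi' (by omega), hladder,
    ← Multiset.singleton_add, ← Multiset.singleton_add (R + 1, true), ← add_assoc, ← add_assoc,
    Multiset.map_add _ (_ + _) (Multiset.replicate _ _), Multiset.map_replicate, cast_typeRep_top,
    Multiset.coe_replicate]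

theorem coe_doubleAst_eq (g : ℕ → Bool) :
    ((((List.ofFn fun i : Fin R => ((2 ^ (i : ℕ) * ((if g i then 1 else p : ℕ) : ℤ) : ℤ) :
        ZMod (2 ^ (R + 1) * p))) ++ [((2 ^ (R + 1) : ℤ) : ZMod (2 ^ (R + 1) * p))] ++
        [((2 ^ R : ℤ) : ZMod (2 ^ (R + 1) * p))] ++
      List.replicate (2 ^ (R + 1) * p - 1)
        ((2 ^ (R + 1) * p / 2 : ℕ) : ZMod (2 ^ (R + 1) * p))) :
        List (ZMod (2 ^ (R + 1) * p))) : Multiset (ZMod (2 ^ (R + 1) * p))) =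
      (ladder g 0 R + ((R + 1, true) ::ₘ (R, true) ::ₘ
        Multiset.replicate (2 ^ (R + 1) * p - 1) (R, false))).map
          fun x => (typeRep p x : ZMod (2 ^ (R + 1) * p)) := by
  rw [← Multiset.coe_add, ← Multiset.coe_add, ← Multiset.coe_add,
    ← Multiset.singleton_add, ← Multiset.singleton_add (R, true), ← add_assoc, ← add_assoc,
    Multiset.map_add, Multiset.map_add, Multiset.map_add, map_ladder_zero,
    Multiset.map_replicate, two_pow_succ_mul_div_two, Multiset.coe_replicate,
    coe_ofFn_val R fun i =>
      ((2 ^ i * ((if g i then 1 else p : ℕ) : ℤ) : ℤ) : ZMod (2 ^ (R + 1) * p))]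
  congr 1
  simp [typeRep]

end Forms

/-! ### Lengths of the listed forms -/

section Lengths

variable {k : ℕ} {q : Fin k → ℕ}

theorem cardFactors_prod_primes (hq : ∀ i, (q i).Prime) :
    ArithmeticFunction.cardFactors (∏ i, q i) = k := by
  rw [Finset.prod, ArithmeticFunction.cardFactors_multiset_prod
    (Finset.prod_ne_zero_iff.2 fun i _ => (hq i).ne_zero), Multiset.map_map]
  simp [ArithmeticFunction.cardFactors_apply_prime (hq _)]

theorem cardFactors_two_pow_mul (r : ℕ) {x : ℕ} (hx : x ≠ 0) :
    ArithmeticFunction.cardFactors (2 ^ r * x) = r + ArithmeticFunction.cardFactors x := by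
  rw [ArithmeticFunction.cardFactors_mul (by positivity) hx,
    ArithmeticFunction.cardFactors_apply_prime_pow Nat.prime_two]

theorem eq_of_two_pow_mul_odd_eq {a b x y : ℕ} (hx : Odd x) (hy : Odd y)
    (h : 2 ^ a * x = 2 ^ b * y) : a = b := by
  have key : ∀ c z, Odd z → padicValNat 2 (2 ^ c * z) = c := fun c z hz => by
    rw [padicValNat.mul (by positivity) hz.pos.ne', padicValNat.prime_pow,
      padicValNat.eq_zero_of_not_dvd fun hd => Nat.not_even_iff_odd.2 hz (even_iff_two_dvd.2 hd),
      add_zero]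
  rw [← key a x hx, h, key b y hy]

end Lengths

/-- For `n = 2 ^ r * p`, `p` an odd prime, `r ≥ 2`: a sequence in `ZMod n` with exactly
one odd term is a `U(n)`-extremal sequence for the Gao constant iff it is
`U(n)`-equivalent to a sequence of one of the forms `(⋆)`, `(∗)` or `(∗∗)`. -/
theorem gao_extremal_iff_of_one_odd (r p : ℕ) (hr : 2 ≤ r) (hp : p.Prime)
    (hpodd : p ≠ 2) (S : List (ZMod (2 ^ r * p)))
    (h1 : pcount (fun x => ZMod.castHom
        (dvd_mul_of_dvd_left (dvd_pow_self 2 (by omega)) p) (ZMod 2) x = 1) S = 1) :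
    IsGaoExtremal (2 ^ r * p) (U (2 ^ r * p)) S ↔
      ((∃ (k : ℕ) (q : Fin k → ℕ) (b : Fin k → ℤ),
          (∀ i, (q i).Prime) ∧ 2 ^ r * p = ∏ i, q i ∧
          (∀ i, IsCoprime (b i) ((q i : ℤ))) ∧
          AEquiv (U (2 ^ r * p)) S
            ((List.ofFn fun i : Fin k =>
                (((∏ j ∈ Finset.Iio i, (q j : ℤ)) * b i : ℤ) : ZMod (2 ^ r * p))) ++
              List.replicate (2 ^ r * p - 1) (0 : ZMod (2 ^ r * p)))) ∨
       (∃ (k : ℕ) (q : Fin k → ℕ) (b : Fin k → ℤ) (m : ℕ),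
          (∀ i, (q i).Prime) ∧ 2 ^ r * p = 2 * ∏ i, q i ∧
          (∀ i, IsCoprime (b i) ((q i : ℤ))) ∧ Odd m ∧ m ≤ 2 ^ r * p ∧
          AEquiv (U (2 ^ r * p)) S
            ((List.ofFn fun i : Fin k =>
                (((∏ j ∈ Finset.Iio i, (q j : ℤ)) * b i : ℤ) : ZMod (2 ^ r * p))) ++
              (List.replicate m ((2 ^ r * p / 2 : ℕ) : ZMod (2 ^ r * p)) ++
                List.replicate (2 ^ r * p - m) (0 : ZMod (2 ^ r * p))))) ∨
       (∃ (s k : ℕ) (q : Fin k → ℕ) (a : Fin s → ℤ) (c : ℤ) (b : Fin k → ℤ),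
          (∀ i, (q i).Prime) ∧ (∀ i, q i ≠ 2) ∧ 2 ^ r * p = 2 ^ (s + 1) * ∏ i, q i ∧
          (∀ i, Odd (a i)) ∧ (2 ^ (s + 1) : ℤ) ∣ c ∧
          (∀ i, Odd (b i) ∧ IsCoprime (b i) ((q i : ℤ))) ∧
          ((2 ≤ k ∧
            AEquiv (U (2 ^ r * p)) S
              ((List.ofFn fun i : Fin s => ((2 ^ (i : ℕ) * a i : ℤ) : ZMod (2 ^ r * p))) ++
                [((c : ℤ) : ZMod (2 ^ r * p))] ++
                (List.ofFn fun i : Fin k =>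
                  ((2 ^ s * (∏ j ∈ Finset.Iio i, (q j : ℤ)) * b i : ℤ) : ZMod (2 ^ r * p))) ++
                List.replicate (2 ^ r * p - 1) ((2 ^ r * p / 2 : ℕ) : ZMod (2 ^ r * p)))) ∨
           (k = 1 ∧
            AEquiv (U (2 ^ r * p)) S
              ((List.ofFn fun i : Fin s => ((2 ^ (i : ℕ) * a i : ℤ) : ZMod (2 ^ r * p))) ++
                [((c : ℤ) : ZMod (2 ^ r * p))] ++ [((2 ^ s : ℤ) : ZMod (2 ^ r * p))] ++
                List.replicate (2 ^ r * p - 1) ((2 ^ r * p / 2 : ℕ) : ZMod (2 ^ r * p))))))) := by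
  obtain ⟨R, rfl⟩ : ∃ R, r = R + 1 := ⟨r - 1, by omega⟩
  clear h1
  have hpo : Odd p := hp.odd_of_ne_two hpodd
  have hn4 : 4 ≤ 2 ^ (R + 1) * p :=
    Nat.mul_le_mul (by simpa using Nat.pow_le_pow_right two_pos (by omega : 1 ≤ R + 1)) hp.two_le
  have hn0 : 0 < 2 ^ (R + 1) * p := by omega
  have hcardFactors : ArithmeticFunction.cardFactors (2 ^ (R + 1) * p) = R + 2 := by
    rw [cardFactors_two_pow_mul _ hp.ne_zero, ArithmeticFunction.cardFactors_apply_prime hp]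
  have hext : IsGaoExtremal (2 ^ (R + 1) * p) (U (2 ^ (R + 1) * p)) S ↔
      S.length = 2 ^ (R + 1) * p + R + 1 ∧
        ¬ HasUnitZeroSum (S : Multiset (ZMod (2 ^ (R + 1) * p))) (2 ^ (R + 1) * p) := by
    rw [IsGaoExtremal, gaoC_units_eq (by omega) hp hpodd, hasWZSS_iff hn0, Nat.add_sub_cancel,
      ← add_assoc]
  have hback : ∀ F : List (ZMod (2 ^ (R + 1) * p)), F.length = 2 ^ (R + 1) * p + R + 1 →
      ¬ HasUnitZeroSum (F : Multiset (ZMod (2 ^ (R + 1) * p))) (2 ^ (R + 1) * p) →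
      AEquiv (U (2 ^ (R + 1) * p)) S F →
      IsGaoExtremal (2 ^ (R + 1) * p) (U (2 ^ (R + 1) * p)) S := fun F hF hbad h => by
    rw [aEquiv_iff] at h
    have hc := Multiset.card_eq_card_of_rel h
    rw [Multiset.coe_card, Multiset.coe_card, hF] at hc
    exact hext.2 ⟨hc, fun hS => hbad (hS.of_rel h)⟩
  constructor
  · intro h
    obtain ⟨hlen, hbad⟩ := hext.1 h
    obtain ⟨M, hM, hrel⟩ := exists_rel_typeRep hp (S : Multiset (ZMod (2 ^ (R + 1) * p)))
    have hc := Multiset.card_eq_card_of_rel hrel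
    rw [Multiset.card_map, Multiset.coe_card, hlen] at hc
    have hshape := isExtremalShape_of_not_hasBalanced (n := 2 ^ (R + 1) * p) (j := 0)
      (Nat.mod_eq_zero_of_dvd ((dvd_pow_self 2 (by omega)).mul_right p)) hn4 R (by omega)
      (fun x _ => Nat.zero_le _) hM hc.symm
      fun hb => hbad ((hb.hasUnitZeroSum hp hpodd).of_rel hrel.associated_symm)
    rcases hshape with ⟨g, t, v, m, htR, htv, -, -, hg, hm, hmn, rfl⟩ | ⟨g, rfl⟩ | ⟨g, rfl⟩
    · refine Or.inr (Or.inl ⟨R + 1, fun i => primeAt p t i, fun i => chainCofactor p t v g i, m,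
        fun i => primeAt_prime hp t i, ?_, fun i => isCoprime_chainCofactor hp hpodd t v g i,
        Nat.odd_iff.2 hm, hmn, ?_⟩)
      · rw [Fin.prod_univ_eq_prod_range (primeAt p t), prod_range_primeAt, if_neg (by omega),
          Nat.add_sub_cancel]
        ring
      · rwa [aEquiv_iff, coe_ast_eq htR htv hg]
    · refine Or.inl ⟨R + 2, fun i => primeAt p (R + 1) i,
        fun i => chainCofactor p (R + 1) (R + 1) (Function.update g R true) i,
        fun i => primeAt_prime hp _ i, ?_, fun i => isCoprime_chainCofactor hp hpodd _ _ _ i, ?_⟩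
      · rw [Fin.prod_univ_eq_prod_range (primeAt p (R + 1)), prod_range_primeAt,
          if_neg (by omega)]
        rfl
      · rwa [aEquiv_iff, coe_star_eq]
    · refine Or.inr (Or.inr ⟨R, 1, fun _ => p, fun i => ((if g i then 1 else p : ℕ) : ℤ),
        2 ^ (R + 1), fun _ => 1, fun _ => hp, fun _ => hpodd, by simp, fun i => ?_, dvd_rfl,
        fun _ => ⟨odd_one, isCoprime_one_left⟩, Or.inr ⟨rfl, ?_⟩⟩)
      · rw [Int.odd_coe_nat]
        exact Nat.coprime_two_right.1 (coprime_two_ite hp hpodd (g i))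
      · rw [aEquiv_iff]
        have e := coe_doubleAst_eq (R := R) (p := p) g
        push_cast at e hrel ⊢
        rwa [e]
  · rintro (⟨k, q, b, hq, hn, hb, h⟩ | ⟨k, q, b, m, hq, hn, hb, hm, hmn, h⟩ |
      ⟨s, k, q, a, c, b, hq, hq2, hn, ha, hc, hb, h⟩)
    · have hk : k = R + 2 := by rw [← cardFactors_prod_primes hq, ← hn, hcardFactors]
      refine hback _ ?_ (not_hasUnitZeroSum_star hn0 hq hn hb) h
      rw [List.length_append, List.length_ofFn, List.length_replicate]
      omega
    · have hk : R + 2 = 1 + k := by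
        rw [← hcardFactors, hn, ← pow_one 2, cardFactors_two_pow_mul _
          (Finset.prod_ne_zero_iff.2 fun i _ => (hq i).ne_zero), cardFactors_prod_primes hq]
      refine hback _ ?_ (not_hasUnitZeroSum_ast rfl hpo hq hn hb hm hmn) h
      rw [List.length_append, List.length_append, List.length_ofFn, List.length_replicate,
        List.length_replicate]
      omega
    · obtain rfl : R = s := Nat.succ_injective (eq_of_two_pow_mul_odd_eq hpo
        (Finset.prod_induction _ Odd (fun _ _ => Odd.mul) odd_one
          fun i _ => (hq i).odd_of_ne_two (hq2 i)) hn)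
      have hk : R + 2 = R + 1 + k := by
        rw [← hcardFactors, hn, cardFactors_two_pow_mul _
          (Finset.prod_ne_zero_iff.2 fun i _ => (hq i).ne_zero), cardFactors_prod_primes hq]
      rcases h with ⟨h2, -⟩ | ⟨-, h⟩
      · omega
      · refine hback _ ?_ (not_hasUnitZeroSum_doubleAst hp hpodd rfl a ha hc) h
        simp only [List.length_append, List.length_ofFn, List.length_replicate,
          List.length_singleton]
        omega
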